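/- arXiv:2006.00451 — 3 statements merged into one kernel-verified Lean document; each statement's English description precedes it below -/
import Mathlib

section
/- Let f : X → Y be a morphism of schemes of finite type over an algebraically closed field k. For every point z of X, the local dimension of X at z minus the local dimension of Y at f(z) is at most the local dimension at z of the fiber f⁻¹(f(z)). -/
open AlgebraicGeometry CategoryTheory Topology

/-- The local dimension of a topological space at a point: the supremum of the
Krull dimensions of the irreducible components containing the point. -/
noncomputable def localDim (X : Type*) [TopologicalSpace X] (z : X) : WithBot ℕ∞ :=
  ⨆ C ∈ {C ∈ irreducibleComponents X | z ∈ C}, topologicalKrullDim C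

universe u

lemma MvPolynomial.height_eq_of_isMaximal {k : Type*} [Field k] (n : ℕ)
    (m : Ideal (MvPolynomial (Fin n) k)) [m.IsMaximal] : m.height = n := by
  induction n with
  | zero =>
    have := ringKrullDim_eq_of_ringEquiv (MvPolynomial.isEmptyRingEquiv k (Fin 0))
    rw [ringKrullDim_eq_zero_of_field] at this
    have h := Ideal.height_le_ringKrullDim_of_ne_top (I := m) Ideal.IsPrime.ne_top'
    rw [this] at h
    simpa using h
  | succ n ih =>
    let e := (MvPolynomial.finSuccEquiv k n).toRingEquiv
    let m' : Ideal (Polynomial (MvPolynomial (Fin n) k)) := m.map e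
    have : m'.IsMaximal := Ideal.map_isMaximal_of_equiv e
    have h1 : m'.height = m.height := e.height_map m
    let m₀ : Ideal (MvPolynomial (Fin n) k) := m'.comap Polynomial.C
    have : m₀.IsMaximal := Polynomial.isMaximal_comap_C_of_isJacobsonRing m'
    have : m'.LiesOver m₀ := ⟨rfl⟩
    rw [← h1, Polynomial.height_eq_height_add_one m₀ m', ih]
    simp

lemma Algebra.FiniteType.exists_trdeg_eq_height_eq (k B : Type u) [Field k] [CommRing B]
    [IsDomain B]
    [Algebra k B] [Algebra.FiniteType k B] :
    ∃ s : ℕ, Algebra.trdeg k B = s ∧ ∀ m : Ideal B, m.IsMaximal → m.height = s := by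
  obtain ⟨s, g, hg, hfin⟩ := exists_finite_inj_algHom_of_fg k B
  algebraize [g.toRingHom]
  have : Module.Finite (MvPolynomial (Fin s) k) B := hfin
  have : FaithfulSMul (MvPolynomial (Fin s) k) B :=
    (faithfulSMul_iff_algebraMap_injective _ _).mpr hg
  have : IsScalarTower k (MvPolynomial (Fin s) k) B := .of_algebraMap_eq' g.comp_algebraMap.symm
  have : IsNoetherianRing B := Algebra.FiniteType.isNoetherianRing k B
  refine ⟨s, ?_, fun m hm ↦ ?_⟩
  · rw [← _root_.trdeg_add_eq k (MvPolynomial (Fin s) k), MvPolynomial.trdeg_of_isDomain,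
      _root_.trdeg_eq_zero]
    simp
  · let m₀ := m.under (MvPolynomial (Fin s) k)
    have : m₀.IsMaximal := Ideal.isMaximal_comap_of_isIntegral_of_isMaximal m
    have h := MvPolynomial.height_eq_of_isMaximal s m₀
    apply le_antisymm
    · rw [← h, (⟨m, hm.isPrime⟩ : PrimeSpectrum B).height_eq_orderHeight,
        (⟨m₀, inferInstance⟩ : PrimeSpectrum (MvPolynomial (Fin s) k)).height_eq_orderHeight]
      exact Order.height_le_height_apply_of_strictMono
        (PrimeSpectrum.comap (algebraMap (MvPolynomial (Fin s) k) B))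
        (fun a b hab ↦ Ideal.IsIntegral.comap_lt_comap hab) ⟨m, hm.isPrime⟩
    · rw [← h, Ideal.height_eq_height_add_of_liesOver_of_hasGoingDown m₀ m]
      exact le_self_add

open nonZeroDivisors

lemma Algebra.FiniteType.exists_trdeg_eq_height_eq_genericFiber (R C : Type u) [CommRing R]
    [IsDomain R] [CommRing C]
    [IsDomain C] [Algebra R C] [FaithfulSMul R C] [Algebra.FiniteType R C] :
    ∃ s : ℕ, Algebra.trdeg R C = s ∧
      ∀ m : Ideal (Localization (Algebra.algebraMapSubmonoid C R⁰)), m.IsMaximal →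
        m.height = s := by
  let M := Algebra.algebraMapSubmonoid C R⁰
  let L := Localization M
  let K := FractionRing R
  have hM : M ≤ C⁰ := algebraMapSubmonoid_le_nonZeroDivisors_of_faithfulSMul C le_rfl
  have : IsDomain L := IsLocalization.isDomain_localization hM
  have : FaithfulSMul C L :=
    (faithfulSMul_iff_algebraMap_injective _ _).mpr (IsLocalization.injective L hM)
  have : FaithfulSMul K L :=
    (faithfulSMul_iff_algebraMap_injective _ _).mpr (algebraMap K L).injective
  have : Algebra.FiniteType K L := by
    have : IsLocalization (R⁰.map (algebraMap R C)) L :=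
      inferInstanceAs (IsLocalization M L)
    have := RingHom.finiteType_localizationPreserves (algebraMap R C) R⁰ K L
      (RingHom.finiteType_algebraMap.mpr inferInstance)
    rw [← RingHom.finiteType_algebraMap]
    convert this
    refine IsLocalization.ringHom_ext R⁰ ?_
    rw [IsLocalization.map_comp, ← IsScalarTower.algebraMap_eq, ← IsScalarTower.algebraMap_eq]
  have h1 := trdeg_add_eq R K (A := L)
  have h2 := trdeg_add_eq R C (A := L)
  have : Algebra.IsAlgebraic R K := IsLocalization.isAlgebraic K R⁰
  have : Algebra.IsAlgebraic C L := IsLocalization.isAlgebraic L M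
  rw [trdeg_eq_zero (R := R) (A := K), zero_add] at h1
  rw [trdeg_eq_zero (R := C) (A := L), add_zero] at h2
  obtain ⟨s, hs, H⟩ := Algebra.FiniteType.exists_trdeg_eq_height_eq K L
  exact ⟨s, by rw [h2, ← h1, hs], H⟩

lemma Ideal.trdeg_le_height_add_trdeg (k B : Type u) [Field k] [CommRing B] [IsDomain B]
    [Algebra k B] [Algebra.FiniteType k B] (q : Ideal B) [q.IsPrime] :
    Algebra.trdeg k B ≤ q.height.toNat + Algebra.trdeg k (B ⧸ q) := by
  have : FaithfulSMul k (B ⧸ q) :=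
    (faithfulSMul_iff_algebraMap_injective _ _).mpr (algebraMap k (B ⧸ q)).injective
  obtain ⟨ι, x, hx⟩ := exists_isTranscendenceBasis' k (B ⧸ q)
  obtain ⟨y, hy⟩ : ∃ y : ι → B, ∀ i, Ideal.Quotient.mk q (y i) = x i :=
    ⟨fun i ↦ (Ideal.Quotient.mk_surjective (x i)).choose,
      fun i ↦ (Ideal.Quotient.mk_surjective (x i)).choose_spec⟩
  let g := MvPolynomial.aeval (R := k) y
  algebraize [g.toRingHom]
  let R := MvPolynomial ι k
  have : IsScalarTower k R B := .of_algebraMap_eq' g.comp_algebraMap.symm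
  have hgx (r : R) : algebraMap R (B ⧸ q) r = MvPolynomial.aeval x r := by
    rw [IsScalarTower.algebraMap_apply R B]
    change Ideal.Quotient.mkₐ k q (MvPolynomial.aeval y r) = _
    rw [MvPolynomial.comp_aeval_apply]
    simp [hy]
  have : FaithfulSMul R (B ⧸ q) := by
    rw [faithfulSMul_iff_algebraMap_injective]
    exact (funext hgx : ⇑(algebraMap R (B ⧸ q)) = MvPolynomial.aeval x) ▸ hx.1
  have : FaithfulSMul R B := by
    rw [faithfulSMul_iff_algebraMap_injective]
    have := FaithfulSMul.algebraMap_injective R (B ⧸ q)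
    rw [IsScalarTower.algebraMap_eq R B (B ⧸ q)] at this
    exact Function.Injective.of_comp (f := algebraMap B (B ⧸ q)) this
  have : Algebra.FiniteType R B := .of_restrictScalars_finiteType k R B
  have hι : Algebra.trdeg k R = Cardinal.mk ι := by
    rw [MvPolynomial.trdeg_of_isDomain, Cardinal.lift_id]
  have halg : Algebra.IsAlgebraic R (B ⧸ q) := by
    have h := trdeg_add_eq k R (A := B ⧸ q)
    rw [← hx.cardinalMk_eq_trdeg, hι] at h
    have hfin : Cardinal.mk ι < Cardinal.aleph0 := by
      rw [hx.cardinalMk_eq_trdeg]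
      exact trdeg_lt_aleph0_of_finiteType
    rw [← trdeg_eq_zero_iff]
    exact Cardinal.eq_of_add_eq_add_left (h.trans (add_zero _).symm) hfin
  obtain ⟨s, hs, H⟩ := Algebra.FiniteType.exists_trdeg_eq_height_eq_genericFiber R B
  let M := Algebra.algebraMapSubmonoid B R⁰
  let L := Localization M
  have hq : Disjoint (M : Set B) q := by
    rw [Set.disjoint_left]
    rintro _ ⟨r, hr, rfl⟩ hrq
    refine nonZeroDivisors.ne_zero hr (FaithfulSMul.algebraMap_injective R (B ⧸ q) ?_)
    rw [map_zero, IsScalarTower.algebraMap_apply R B]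
    exact Ideal.Quotient.eq_zero_iff_mem.mpr hrq
  have : (q.map (algebraMap B L)).IsPrime := IsLocalization.isPrime_of_isPrime_disjoint M L q ‹_› hq
  obtain ⟨m, hm, hqm⟩ := Ideal.exists_le_maximal (q.map (algebraMap B L)) this.ne_top
  have hle : q ≤ m.under B := Ideal.map_le_iff_le_comap.mp hqm
  have hdisj := (IsLocalization.disjoint_under_iff M L m).mpr hm.ne_top
  have heq : m.under B = q := by
    refine le_antisymm (fun b hb ↦ ?_) hle
    by_contra hbq
    let I := (m.under B).map (Ideal.Quotient.mk q)
    have hI : I.comap (algebraMap R (B ⧸ q)) ≠ ⊥ :=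
      Ideal.comap_ne_bot_of_algebraic_mem (x := Ideal.Quotient.mk q b)
        (fun h ↦ hbq (Ideal.Quotient.eq_zero_iff_mem.mp h)) (Ideal.mem_map_of_mem _ hb)
        (Algebra.IsAlgebraic.isAlgebraic _)
    obtain ⟨r, hr, hr0⟩ := Submodule.exists_mem_ne_zero_of_ne_bot hI
    refine Set.disjoint_left.mp hdisj ⟨r, mem_nonZeroDivisors_of_ne_zero hr0, rfl⟩ ?_
    rw [Ideal.mem_comap, IsScalarTower.algebraMap_apply R B, Ideal.Quotient.algebraMap_eq,
      Ideal.mem_map_iff_of_surjective _ Ideal.Quotient.mk_surjective] at hr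
    obtain ⟨c, hc, hcr⟩ := hr
    have := sub_mem hc (hle (Ideal.Quotient.eq.mp hcr))
    simpa using this
  have hh : q.height = s := by
    rw [← heq, IsLocalization.height_under M, H m hm]
  rw [hh, ← trdeg_add_eq k R (A := B), hs, ← hx.cardinalMk_eq_trdeg, hι, add_comm]
  rfl

lemma ENat.exists_le_and_le_of_coe_le_add {N : ℕ} {x y : ℕ∞} (h : (N : ℕ∞) ≤ x + y) :
    ∃ n m : ℕ, (n : ℕ∞) ≤ x ∧ (m : ℕ∞) ≤ y ∧ N ≤ n + m := by
  induction x with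
  | top => exact ⟨N, 0, le_top, by simp, by simp⟩
  | coe x =>
    induction y with
    | top => exact ⟨0, N, by simp, le_top, by simp⟩
    | coe y => exact ⟨x, y, le_rfl, le_rfl, by exact_mod_cast h⟩

lemma LTSeries.exists_head_le_of_le_height_of_le_coheight {α : Type*} [Preorder α] {a : α}
    {n m : ℕ} (hn : (n : ℕ∞) ≤ Order.height a) (hm : (m : ℕ∞) ≤ Order.coheight a) :
    ∃ l : LTSeries α, l.head ≤ a ∧ l.length = n + m := by
  obtain ⟨r, hr, rfl⟩ := Order.exists_series_of_le_height a hn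
  obtain ⟨s, hs, rfl⟩ := Order.exists_series_of_le_coheight a hm
  refine ⟨r.smash s (hr.trans hs.symm), ?_, rfl⟩
  rw [RelSeries.head_smash, ← hr]
  exact LTSeries.head_le_last r

lemma PrimeSpectrum.exists_trdeg_eq_le_coheight (k : Type u) {A : Type u} [Field k] [CommRing A]
    [Algebra k A] [Algebra.FiniteType k A] (p : PrimeSpectrum A) :
    ∃ s : ℕ, Algebra.trdeg k (A ⧸ p.asIdeal) = s ∧ (s : ℕ∞) ≤ Order.coheight p := by
  obtain ⟨s, hs, H⟩ := Algebra.FiniteType.exists_trdeg_eq_height_eq k (A ⧸ p.asIdeal)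
  refine ⟨s, hs, ?_⟩
  obtain ⟨m, hm⟩ := Ideal.exists_maximal (A ⧸ p.asIdeal)
  have hmh := H m hm
  rw [(⟨m, hm.isPrime⟩ : PrimeSpectrum (A ⧸ p.asIdeal)).height_eq_orderHeight] at hmh
  obtain ⟨l, -, rfl⟩ := Order.exists_series_of_le_height _ hmh.ge
  refine Order.length_le_coheight (p := l.map (comap (Ideal.Quotient.mk p.asIdeal))
    (RingHom.strictMono_comap_of_surjective Ideal.Quotient.mk_surjective)) ?_
  intro a ha
  simp [Ideal.Quotient.eq_zero_iff_mem.mpr ha]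

lemma PrimeSpectrum.exists_trdeg_eq_le_coheight_fiber {A B : Type u} [CommRing A] [CommRing B]
    [Algebra A B] [Algebra.FiniteType A B] (q : PrimeSpectrum B) (p : PrimeSpectrum A)
    (hq : comap (algebraMap A B) q = p) [q.asIdeal.LiesOver p.asIdeal] :
    ∃ s : ℕ, Algebra.trdeg (A ⧸ p.asIdeal) (B ⧸ q.asIdeal) = s ∧
      (s : ℕ∞) ≤ Order.coheight (⟨q, hq⟩ : comap (algebraMap A B) ⁻¹' {p}) := by
  have : FaithfulSMul (A ⧸ p.asIdeal) (B ⧸ q.asIdeal) := inferInstance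
  have : Algebra.FiniteType A (B ⧸ q.asIdeal) := inferInstance
  have : Algebra.FiniteType (A ⧸ p.asIdeal) (B ⧸ q.asIdeal) :=
    .of_restrictScalars_finiteType A _ _
  obtain ⟨s, hs, H⟩ := Algebra.FiniteType.exists_trdeg_eq_height_eq_genericFiber
    (A ⧸ p.asIdeal) (B ⧸ q.asIdeal)
  refine ⟨s, hs, ?_⟩
  let M := Algebra.algebraMapSubmonoid (B ⧸ q.asIdeal) (A ⧸ p.asIdeal)⁰
  let L := Localization M
  have : IsDomain L := IsLocalization.isDomain_localization
    (algebraMapSubmonoid_le_nonZeroDivisors_of_faithfulSMul _ le_rfl)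
  obtain ⟨m, hm⟩ := Ideal.exists_maximal L
  have hmh := H m hm
  rw [(⟨m, hm.isPrime⟩ : PrimeSpectrum L).height_eq_orderHeight] at hmh
  obtain ⟨l, -, rfl⟩ := Order.exists_series_of_le_height _ hmh.ge
  let φ : PrimeSpectrum L → PrimeSpectrum B := fun x ↦
    comap (Ideal.Quotient.mk q.asIdeal) (comap (algebraMap (B ⧸ q.asIdeal) L) x)
  have hφ : StrictMono φ :=
    (RingHom.strictMono_comap_of_surjective Ideal.Quotient.mk_surjective).comp
      (Monotone.strictMono_of_injective (fun _ _ h ↦ Ideal.comap_mono h)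
        (localization_comap_injective L M))
  have hqφ (x) : q ≤ φ x := fun a ha ↦ by
    simp [φ, Ideal.Quotient.eq_zero_iff_mem.mpr ha]
  have hpφ (x) : comap (algebraMap A B) (φ x) = p := by
    refine le_antisymm (fun a ha ↦ ?_) (hq ▸ Ideal.comap_mono (hqφ x))
    by_contra hap
    refine Set.disjoint_left.mp ((IsLocalization.disjoint_under_iff M L x.asIdeal).mpr
      x.isPrime.ne_top) ⟨Ideal.Quotient.mk p.asIdeal a, mem_nonZeroDivisors_of_ne_zero
        fun h ↦ hap (Ideal.Quotient.eq_zero_iff_mem.mp h), rfl⟩ ha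
  let ψ : PrimeSpectrum L → comap (algebraMap A B) ⁻¹' {p} := fun x ↦ ⟨φ x, hpφ x⟩
  exact Order.length_le_coheight (p := l.map ψ fun _ _ h ↦ hφ h) (hqφ l.head)

lemma PrimeSpectrum.height_map_quotientMk_le {A B : Type u} [CommRing A] [CommRing B]
    [Algebra A B] [IsNoetherianRing A] [IsNoetherianRing B] (P q : PrimeSpectrum B) (hPq : P ≤ q)
    (p : PrimeSpectrum A) (hq : comap (algebraMap A B) q = p) :
    (q.asIdeal.map (Ideal.Quotient.mk P.asIdeal)).height ≤ Order.height p +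
      Order.height (⟨q, hq⟩ : comap (algebraMap A B) ⁻¹' {p}) := by
  let Q := q.asIdeal.map (Ideal.Quotient.mk P.asIdeal)
  have hQq : Q.comap (Ideal.Quotient.mk P.asIdeal) = q.asIdeal := by
    rw [Ideal.comap_map_of_surjective _ Ideal.Quotient.mk_surjective, ← RingHom.ker_eq_comap_bot,
      Ideal.mk_ker, sup_eq_left]
    exact hPq
  have hQ : Q.IsPrime := Ideal.map_isPrime_of_surjective Ideal.Quotient.mk_surjective
    (by rw [Ideal.mk_ker]; exact hPq)
  have : Q.LiesOver p.asIdeal := by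
    refine ⟨?_⟩
    rw [Ideal.under_def, IsScalarTower.algebraMap_eq A B (B ⧸ P.asIdeal), ← Ideal.comap_comap,
      Ideal.Quotient.algebraMap_eq, hQq, ← hq]
    rfl
  let J := p.asIdeal.map (algebraMap A (B ⧸ P.asIdeal))
  refine (Ideal.height_le_height_add_of_liesOver p.asIdeal Q).trans ?_
  rw [p.height_eq_orderHeight]
  gcongr
  have hJQ : J ≤ Q := Ideal.map_le_iff_le_comap.mpr (Ideal.over_def Q p.asIdeal).le
  have hQ' : (Q.map (Ideal.Quotient.mk J)).IsPrime :=
    Ideal.map_isPrime_of_surjective Ideal.Quotient.mk_surjective (by rw [Ideal.mk_ker]; exact hJQ)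
  rw [(⟨_, hQ'⟩ : PrimeSpectrum ((B ⧸ P.asIdeal) ⧸ J)).height_eq_orderHeight]
  refine Order.height_le fun l hl ↦ ?_
  let φ : PrimeSpectrum ((B ⧸ P.asIdeal) ⧸ J) → PrimeSpectrum B := fun x ↦
    comap (Ideal.Quotient.mk P.asIdeal) (comap (Ideal.Quotient.mk J) x)
  have hφ : StrictMono φ :=
    (RingHom.strictMono_comap_of_surjective Ideal.Quotient.mk_surjective).comp
      (RingHom.strictMono_comap_of_surjective Ideal.Quotient.mk_surjective)
  have hφq : φ l.last = q := by
    rw [hl]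
    ext1
    change ((Q.map (Ideal.Quotient.mk J)).comap (Ideal.Quotient.mk J)).comap
      (Ideal.Quotient.mk P.asIdeal) = q.asIdeal
    rw [Ideal.comap_map_of_surjective _ Ideal.Quotient.mk_surjective, ← RingHom.ker_eq_comap_bot,
      Ideal.mk_ker, sup_eq_left.mpr hJQ, hQq]
  have hpφ (i) : comap (algebraMap A B) (φ (l i)) = p := by
    refine le_antisymm (hq ▸ hφq ▸ Ideal.comap_mono (hφ.monotone (LTSeries.monotone l
      (Fin.le_last i)))) fun a ha ↦ ?_
    change Ideal.Quotient.mk J (algebraMap A (B ⧸ P.asIdeal) a) ∈ (l i).asIdeal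
    rw [Ideal.Quotient.eq_zero_iff_mem.mpr (Ideal.mem_map_of_mem _ ha)]
    exact zero_mem _
  let l' : LTSeries (comap (algebraMap A B) ⁻¹' {p}) :=
    { length := l.length
      toFun i := ⟨φ (l i), hpφ i⟩
      step i := hφ (l.step i) }
  exact Order.length_le_height (p := l') hφq.le

/-- The dimension inequality for finite type algebras: the dimension of an irreducible closed subset
of `Spec B` is bounded by a chain of primes in a fiber of `Spec B → Spec A`, and a chain of primes
in the base, passing through given points. -/
lemma PrimeSpectrum.exists_ltSeries_trdeg_le {k A B : Type u} [Field k] [CommRing A] [CommRing B]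
    [Algebra k A] [Algebra k B] [Algebra A B] [IsScalarTower k A B] [Algebra.FiniteType k A]
    [Algebra.FiniteType k B] (P q : PrimeSpectrum B) (hPq : P ≤ q)
    (p : PrimeSpectrum A) (hq : comap (algebraMap A B) q = p) :
    ∃ (l : LTSeries (comap (algebraMap A B) ⁻¹' {p})) (m : LTSeries (PrimeSpectrum A)),
      l.head.1 ≤ q ∧ m.head ≤ p ∧
      Algebra.trdeg k (B ⧸ P.asIdeal) ≤ ((l.length + m.length : ℕ) : Cardinal) := by
  have : IsNoetherianRing A := Algebra.FiniteType.isNoetherianRing k A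
  have : IsNoetherianRing B := Algebra.FiniteType.isNoetherianRing k B
  have : Algebra.FiniteType A B := .of_restrictScalars_finiteType k A B
  have : q.asIdeal.LiesOver p.asIdeal := ⟨by rw [← hq]; rfl⟩
  obtain ⟨a, ha, ha'⟩ := exists_trdeg_eq_le_coheight k p
  obtain ⟨b, hb, hb'⟩ := exists_trdeg_eq_le_coheight_fiber q p hq
  have hh := height_map_quotientMk_le P q hPq p hq
  have : (q.asIdeal.map (Ideal.Quotient.mk P.asIdeal)).IsPrime :=
    Ideal.map_isPrime_of_surjective Ideal.Quotient.mk_surjective (by rw [Ideal.mk_ker]; exact hPq)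
  have hcat := Ideal.trdeg_le_height_add_trdeg k (B ⧸ P.asIdeal)
    (q.asIdeal.map (Ideal.Quotient.mk P.asIdeal))
  have e : Algebra.trdeg k ((B ⧸ P.asIdeal) ⧸ q.asIdeal.map (Ideal.Quotient.mk P.asIdeal)) =
      Algebra.trdeg k (B ⧸ q.asIdeal) := (DoubleQuot.quotQuotEquivQuotOfLEₐ k hPq).trdeg_eq
  have : FaithfulSMul k (A ⧸ p.asIdeal) :=
    (faithfulSMul_iff_algebraMap_injective _ _).mpr (algebraMap k (A ⧸ p.asIdeal)).injective
  have : IsScalarTower k (A ⧸ p.asIdeal) (B ⧸ q.asIdeal) := inferInstance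
  have hadd := trdeg_add_eq k (A ⧸ p.asIdeal) (A := B ⧸ q.asIdeal)
  obtain ⟨N, hN⟩ := ENat.ne_top_iff_exists.mp (Ideal.height_ne_top_of_isPrime
    (I := q.asIdeal.map (Ideal.Quotient.mk P.asIdeal)))
  rw [← hN] at hh hcat
  obtain ⟨n, m, hn, hm, hnm⟩ := ENat.exists_le_and_le_of_coe_le_add hh
  obtain ⟨l, hl, hl'⟩ := LTSeries.exists_head_le_of_le_height_of_le_coheight hm hb'
  obtain ⟨r, hr, hr'⟩ := LTSeries.exists_head_le_of_le_height_of_le_coheight hn ha'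
  refine ⟨l, r, hl, hr, hcat.trans ?_⟩
  rw [e, ← hadd, ha, hb, hl', hr', ENat.toNat_natCast]
  norm_cast
  omega

lemma PrimeSpectrum.length_le_trdeg (k : Type u) {B : Type u} [Field k] [CommRing B] [Algebra k B]
    [Algebra.FiniteType k B] {P : PrimeSpectrum B} (l : LTSeries (PrimeSpectrum B))
    (hP : P ≤ l.head) : (l.length : Cardinal) ≤ Algebra.trdeg k (B ⧸ P.asIdeal) := by
  obtain ⟨s, hs, H⟩ := Algebra.FiniteType.exists_trdeg_eq_height_eq k (B ⧸ P.asIdeal)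
  let e := P.asIdeal.primeSpectrumQuotientOrderIsoZeroLocus
  have hl (i) : l i ∈ zeroLocus (P.asIdeal : Set B) := hP.trans (LTSeries.head_le l i)
  let r : LTSeries (PrimeSpectrum (B ⧸ P.asIdeal)) :=
    { length := l.length
      toFun i := e.symm ⟨l i, hl i⟩
      step i := e.symm.strictMono (l.step i) }
  obtain ⟨m, hm, hrm⟩ := Ideal.exists_le_maximal r.last.asIdeal r.last.isPrime.ne_top
  have h : (r.length : ℕ∞) ≤ s := by
    rw [← H m hm, (⟨m, hm.isPrime⟩ : PrimeSpectrum (B ⧸ P.asIdeal)).height_eq_orderHeight]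
    exact Order.length_le_height hrm
  rw [hs]
  exact_mod_cast h

lemma Algebra.trdeg_quotient_eq_of_surjective_div (k : Type u) {B K : Type u} [Field k]
    [CommRing B] [Field K] [Algebra k B] [Algebra B K] [Algebra k K] [IsScalarTower k B K]
    (P : Ideal B) (hP : RingHom.ker (algebraMap B K) = P)
    (hK : ∀ x : K, ∃ a b : B, algebraMap B K b ≠ 0 ∧ x * algebraMap B K b = algebraMap B K a) :
    Algebra.trdeg k (B ⧸ P) = Algebra.trdeg k K := by
  subst hP
  let φ : (B ⧸ RingHom.ker (algebraMap B K)) →ₐ[k] K :=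
    Ideal.kerLiftAlg (IsScalarTower.toAlgHom k B K)
  let := φ.toRingHom.toAlgebra
  have hφ : Function.Injective (algebraMap (B ⧸ RingHom.ker (algebraMap B K)) K) :=
    Ideal.kerLiftAlg_injective (IsScalarTower.toAlgHom k B K)
  have : IsDomain (B ⧸ RingHom.ker (algebraMap B K)) := hφ.isDomain
  have : FaithfulSMul (B ⧸ RingHom.ker (algebraMap B K)) K :=
    (faithfulSMul_iff_algebraMap_injective _ _).mpr hφ
  have : FaithfulSMul k (B ⧸ RingHom.ker (algebraMap B K)) :=
    (faithfulSMul_iff_algebraMap_injective _ _).mpr (algebraMap k _).injective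
  have : IsScalarTower k (B ⧸ RingHom.ker (algebraMap B K)) K := .of_algHom φ
  have : IsFractionRing (B ⧸ RingHom.ker (algebraMap B K)) K := by
    refine IsFractionRing.of_field _ _ fun x ↦ ?_
    obtain ⟨a, b, hb, h⟩ := hK x
    exact ⟨Ideal.Quotient.mk _ a, Ideal.Quotient.mk _ b, eq_div_of_mul_eq hb h⟩
  have : Algebra.IsAlgebraic (B ⧸ RingHom.ker (algebraMap B K)) K :=
    IsLocalization.isAlgebraic _ (B ⧸ RingHom.ker (algebraMap B K))⁰
  rw [← trdeg_add_eq k (B ⧸ RingHom.ker (algebraMap B K)) (A := K),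
    trdeg_eq_zero (R := B ⧸ RingHom.ker (algebraMap B K)), add_zero]

section LocalDim

variable {T : Type*} [TopologicalSpace T]

lemma IsIrreducible.topologicalKrullDim_le_localDim {S : Set T} (hS : IsIrreducible S) {z : T}
    (hz : z ∈ S) : topologicalKrullDim S ≤ localDim T z := by
  obtain ⟨C, hC, hSC⟩ := exists_mem_irreducibleComponents_subset_of_isIrreducible S hS
  exact (IsEmbedding.inclusion hSC).isInducing.topologicalKrullDim_le.trans
    (le_iSup₂_of_le C ⟨hC, hSC hz⟩ le_rfl)

lemma LTSeries.length_le_localDim {P : Type*} [PartialOrder P] (l : LTSeries P) (g : P → T)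
    (hg : ∀ a b, g a ⤳ g b ↔ a ≤ b) {z : T} (hz : g l.head ⤳ z) :
    (l.length : WithBot ℕ∞) ≤ localDim T z := by
  have hS : IsIrreducible (closure {g l.head}) := isIrreducible_singleton.closure
  refine le_trans ?_ (hS.topologicalKrullDim_le_localDim (specializes_iff_mem_closure.mp hz))
  have hmem (i) : g (l i) ∈ closure {g l.head} :=
    specializes_iff_mem_closure.mp ((hg _ _).mpr (LTSeries.head_le l i))
  let c (i) : TopologicalSpace.IrreducibleCloseds (closure {g l.head}) :=
    ⟨closure {⟨g (l i), hmem i⟩}, isIrreducible_singleton.closure, isClosed_closure⟩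
  have hc (i j) : c i ≤ c j ↔ l j ≤ l i := by
    rw [← hg]
    change closure {(⟨g (l i), hmem i⟩ : closure {g l.head})} ⊆ closure {⟨g (l j), hmem j⟩} ↔ _
    rw [← specializes_iff_closure_subset, subtype_specializes_iff]
  let m : LTSeries (TopologicalSpace.IrreducibleCloseds (closure {g l.head})) :=
    { length := l.length
      toFun i := c i.rev
      step i := by
        have := l.step i.rev
        refine lt_iff_le_not_ge.mpr ⟨(hc _ _).mpr ?_, mt (hc _ _).mp ?_⟩
        · simpa [Fin.rev_castSucc, Fin.rev_succ] using this.le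
        · simpa [Fin.rev_castSucc, Fin.rev_succ] using this.not_ge }
  exact Order.LTSeries.length_le_krullDim m

lemma LTSeries.exists_points_of_irreducibleCloseds [QuasiSober T]
    (l : LTSeries (TopologicalSpace.IrreducibleCloseds T)) :
    ∃ x : Fin (l.length + 1) → T, ∀ i j, x j ⤳ x i ↔ i ≤ j := by
  choose x hx using fun i ↦ QuasiSober.sober (l i).isIrreducible (l i).isClosed
  refine ⟨x, fun i j ↦ ?_⟩
  rw [specializes_iff_closure_subset, (hx i).def, (hx j).def, ← l.strictMono.le_iff_le]
  rfl

end LocalDim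

namespace AlgebraicGeometry

lemma Scheme.Hom.le_preimage_top {X Y : Scheme.{u}} (f : X ⟶ Y) (U : X.Opens) : U ≤ f ⁻¹ᵁ ⊤ :=
  le_top

/-- The ring homomorphism `k → Γ(X, U)` given by a morphism `X ⟶ Spec k`. -/
noncomputable def Scheme.Hom.sectionsRingHom {k : Type u} [CommRing k] {X : Scheme.{u}}
    (s : X ⟶ Spec (.of k)) (U : X.Opens) : k →+* Γ(X, U) :=
  ((Scheme.ΓSpecIso (.of k)).inv ≫ s.appLE ⊤ U (s.le_preimage_top U)).hom

lemma Scheme.Hom.finiteType_sectionsRingHom {k : Type u} [CommRing k] {X : Scheme.{u}}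
    (s : X ⟶ Spec (.of k)) [LocallyOfFiniteType s] {U : X.Opens} (hU : IsAffineOpen U) :
    (s.sectionsRingHom U).FiniteType :=
  (s.finiteType_appLE (isAffineOpen_top _) hU (s.le_preimage_top U)).comp
    (.of_surjective _ (Scheme.ΓSpecIso (.of k)).commRingCatIsoToRingEquiv.symm.surjective)

lemma Scheme.Hom.evaluation_sectionsRingHom {k : Type u} [CommRing k] {X : Scheme.{u}}
    (s : X ⟶ Spec (.of k)) {U : X.Opens} {x : X} (hx : x ∈ U) (a : k) :
    X.evaluation U x hx (s.sectionsRingHom U a) =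
      X.evaluation ⊤ x (TopologicalSpace.Opens.mem_top x) (s.sectionsRingHom ⊤ a) := by
  have : s.appLE ⊤ U (s.le_preimage_top U) ≫ X.evaluation U x hx =
      s.appLE ⊤ ⊤ (s.le_preimage_top ⊤) ≫ X.evaluation ⊤ x (TopologicalSpace.Opens.mem_top x) := by
    simp only [Scheme.Hom.appLE, Scheme.evaluation, Category.assoc]
    rw [X.presheaf.germ_res_assoc, X.presheaf.germ_res_assoc]
  exact congr($this ((Scheme.ΓSpecIso (.of k)).inv a))

lemma Scheme.Hom.appLE_comp_sectionsRingHom {k : Type u} [CommRing k] {X Y : Scheme.{u}}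
    (f : X ⟶ Y) (s : Y ⟶ Spec (.of k)) {U : X.Opens} {V : Y.Opens} (h : U ≤ f ⁻¹ᵁ V) :
    (f.appLE V U h).hom.comp (s.sectionsRingHom V) = (f ≫ s).sectionsRingHom U := by
  rw [sectionsRingHom, sectionsRingHom, ← CommRingCat.hom_comp, Category.assoc,
    Scheme.Hom.appLE_comp_appLE]

lemma IsAffineOpen.ker_evaluation {X : Scheme.{u}} {U : X.Opens} (hU : IsAffineOpen U) {x : X}
    (hx : x ∈ U) :
    RingHom.ker (X.evaluation U x hx).hom = (hU.primeIdealOf ⟨x, hx⟩).asIdeal := by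
  let := TopCat.Presheaf.algebra_section_stalk X.presheaf (U := U) ⟨x, hx⟩
  have : IsLocalization.AtPrime (X.presheaf.stalk x) (hU.primeIdealOf ⟨x, hx⟩).asIdeal :=
    hU.isLocalization_stalk ⟨x, hx⟩
  ext a
  refine (IsLocalRing.residue_eq_zero_iff _).trans ?_
  exact IsLocalization.AtPrime.to_map_mem_maximal_iff (X.presheaf.stalk x) _ a

lemma IsAffineOpen.exists_evaluation_mul_eq {X : Scheme.{u}} {U : X.Opens} (hU : IsAffineOpen U)
    {x : X} (hx : x ∈ U) (y : X.residueField x) :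
    ∃ a b : Γ(X, U), X.evaluation U x hx b ≠ 0 ∧
      y * X.evaluation U x hx b = X.evaluation U x hx a := by
  let := TopCat.Presheaf.algebra_section_stalk X.presheaf (U := U) ⟨x, hx⟩
  have : IsLocalization.AtPrime (X.presheaf.stalk x) (hU.primeIdealOf ⟨x, hx⟩).asIdeal :=
    hU.isLocalization_stalk ⟨x, hx⟩
  obtain ⟨y, rfl⟩ := X.residue_surjective x y
  obtain ⟨⟨a, b⟩, h⟩ := IsLocalization.surj (hU.primeIdealOf ⟨x, hx⟩).asIdeal.primeCompl y
  refine ⟨a, b, fun hb ↦ b.2 ?_, ?_⟩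
  · exact (hU.ker_evaluation hx).le hb
  · exact (map_mul (X.residue x).hom _ _).symm.trans congr(X.residue x $h)

/-- The transcendence degree over `k` of the residue field at a point of a `k`-scheme. -/
noncomputable def Scheme.Hom.residueTrdeg {k : Type u} [Field k] {X : Scheme.{u}}
    (s : X ⟶ Spec (.of k)) (x : X) : Cardinal.{u} :=
  letI := ((X.evaluation ⊤ x (TopologicalSpace.Opens.mem_top x)).hom.comp
    (s.sectionsRingHom ⊤)).toAlgebra
  Algebra.trdeg k (X.residueField x)

lemma IsAffineOpen.trdeg_quotient_primeIdealOf {k : Type u} [Field k] {X : Scheme.{u}}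
    (s : X ⟶ Spec (.of k)) {U : X.Opens} (hU : IsAffineOpen U) {x : X} (hx : x ∈ U) :
    letI := (s.sectionsRingHom U).toAlgebra
    Algebra.trdeg k (Γ(X, U) ⧸ (hU.primeIdealOf ⟨x, hx⟩).asIdeal) = s.residueTrdeg x := by
  let := (s.sectionsRingHom U).toAlgebra
  let := (X.evaluation U x hx).hom.toAlgebra
  let := ((X.evaluation ⊤ x (TopologicalSpace.Opens.mem_top x)).hom.comp
    (s.sectionsRingHom ⊤)).toAlgebra
  have : IsScalarTower k Γ(X, U) (X.residueField x) :=
    .of_algebraMap_eq fun a ↦ (s.evaluation_sectionsRingHom hx a).symm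
  exact Algebra.trdeg_quotient_eq_of_surjective_div k _ (hU.ker_evaluation hx)
    (hU.exists_evaluation_mul_eq hx)

lemma IsAffineOpen.fromSpec_specializes_iff {X : Scheme.{u}} {U : X.Opens} (hU : IsAffineOpen U)
    {p q : PrimeSpectrum Γ(X, U)} : hU.fromSpec p ⤳ hU.fromSpec q ↔ p ≤ q := by
  rw [PrimeSpectrum.le_iff_specializes]
  exact hU.fromSpec.isOpenEmbedding.isInducing.specializes_iff

lemma IsAffineOpen.primeIdealOf_le_iff {X : Scheme.{u}} {U : X.Opens} (hU : IsAffineOpen U)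
    {x y : X} (hx : x ∈ U) (hy : y ∈ U) :
    hU.primeIdealOf ⟨x, hx⟩ ≤ hU.primeIdealOf ⟨y, hy⟩ ↔ x ⤳ y := by
  rw [← hU.fromSpec_specializes_iff, hU.fromSpec_primeIdealOf, hU.fromSpec_primeIdealOf]

/-- The dimension of an irreducible closed subset is at most the transcendence degree of the residue
field at its generic point. -/
lemma Scheme.Hom.topologicalKrullDim_le_residueTrdeg {k : Type u} [Field k] {X : Scheme.{u}}
    (s : X ⟶ Spec (.of k)) [LocallyOfFiniteType s] {C : Set X} {x : X} (hC : IsGenericPoint x C)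
    {N : ℕ} (hN : s.residueTrdeg x ≤ N) : topologicalKrullDim C ≤ N := by
  have : QuasiSober C := hC.isClosed.isClosedEmbedding_subtypeVal.quasiSober
  refine iSup_le fun l ↦ ?_
  obtain ⟨y, hy⟩ := l.exists_points_of_irreducibleCloseds
  obtain ⟨U, hU, hU₀, -⟩ := exists_isAffineOpen_mem_and_subset (x := (y 0).1) (U := ⊤) trivial
  have hyU (i) : (y i).1 ∈ U :=
    ((subtype_specializes_iff _ _).mp ((hy 0 i).mpr (Fin.zero_le i))).mem_open U.2 hU₀
  have hxy (i) : x ⤳ (y i).1 := hC.specializes (y i).2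
  let := (s.sectionsRingHom U).toAlgebra
  have : Algebra.FiniteType k Γ(X, U) := s.finiteType_sectionsRingHom hU
  let r : LTSeries (PrimeSpectrum Γ(X, U)) :=
    { length := l.length
      toFun i := hU.primeIdealOf ⟨_, hyU i.rev⟩
      step i := by
        change hU.primeIdealOf ⟨_, hyU i.castSucc.rev⟩ < hU.primeIdealOf ⟨_, hyU i.succ.rev⟩
        rw [lt_iff_le_not_ge]
        rw [hU.primeIdealOf_le_iff, hU.primeIdealOf_le_iff, ← subtype_specializes_iff,
          ← subtype_specializes_iff, hy, hy, Fin.rev_le_rev, Fin.rev_le_rev, ← lt_iff_le_not_ge]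
        exact i.castSucc_lt_succ }
  have hr := PrimeSpectrum.length_le_trdeg k (P := hU.primeIdealOf ⟨x, (hxy 0).mem_open U.2 hU₀⟩) r
    ((hU.primeIdealOf_le_iff _ _).mpr (hxy _))
  rw [hU.trdeg_quotient_primeIdealOf s] at hr
  have : l.length ≤ N := by exact_mod_cast hr.trans hN
  exact_mod_cast this

lemma IsAffineOpen.apply_fromSpec_of_comap_appLE_eq {X Y : Scheme.{u}} {V : Y.Opens}
    (hV : IsAffineOpen V) {U : X.Opens} (hU : IsAffineOpen U) (f : X ⟶ Y) (h : U ≤ f ⁻¹ᵁ V)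
    {y : Y} (hy : y ∈ V) {w : PrimeSpectrum Γ(X, U)}
    (hw : PrimeSpectrum.comap (f.appLE V U h).hom w = hV.primeIdealOf ⟨y, hy⟩) :
    f (hU.fromSpec w) = y := by
  have hf : f (hU.fromSpec w) = hV.fromSpec (PrimeSpectrum.comap (f.appLE V U h).hom w) :=
    congr($(IsAffineOpen.SpecMap_appLE_fromSpec f hV hU h) w).symm
  rw [hf, hw, hV.fromSpec_primeIdealOf]

/-- The transcendence degree of the residue field at a generization of `z` is bounded by the local
dimension of the fiber plus the local dimension of the base. -/
lemma Scheme.Hom.exists_residueTrdeg_le_of_specializes {k : Type u} [Field k] {X Y : Scheme.{u}}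
    (f : X ⟶ Y) (s : Y ⟶ Spec (.of k)) [LocallyOfFiniteType s] [LocallyOfFiniteType (f ≫ s)]
    {x z : X} (hxz : x ⤳ z) :
    ∃ N M : ℕ, (f ≫ s).residueTrdeg x ≤ ((N + M : ℕ) : Cardinal) ∧
      (N : WithBot ℕ∞) ≤ localDim (f ⁻¹' {f z} : Set X) ⟨z, rfl⟩ ∧
      (M : WithBot ℕ∞) ≤ localDim Y (f z) := by
  obtain ⟨V, hV, hzV, -⟩ := exists_isAffineOpen_mem_and_subset (x := f z) (U := ⊤) trivial
  obtain ⟨U, hU, hzU, hUV⟩ := exists_isAffineOpen_mem_and_subset (x := z) (U := f ⁻¹ᵁ V) hzV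
  have hxU : x ∈ U := hxz.mem_open U.2 hzU
  let := (s.sectionsRingHom V).toAlgebra
  let := ((f ≫ s).sectionsRingHom U).toAlgebra
  let := (f.appLE V U hUV).hom.toAlgebra
  have : IsScalarTower k Γ(Y, V) Γ(X, U) :=
    .of_algebraMap_eq' (f.appLE_comp_sectionsRingHom s hUV).symm
  have : Algebra.FiniteType k Γ(Y, V) := s.finiteType_sectionsRingHom hV
  have : Algebra.FiniteType k Γ(X, U) := (f ≫ s).finiteType_sectionsRingHom hU
  obtain ⟨l, m, hl, hm, h⟩ := PrimeSpectrum.exists_ltSeries_trdeg_le (k := k)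
    (hU.primeIdealOf ⟨x, hxU⟩) (hU.primeIdealOf ⟨z, hzU⟩)
    ((hU.primeIdealOf_le_iff hxU hzU).mpr hxz) (hV.primeIdealOf ⟨f z, hzV⟩)
    (IsAffineOpen.comap_primeIdealOf_appLE V hV U hU hUV hzU)
  rw [hU.trdeg_quotient_primeIdealOf (f ≫ s)] at h
  refine ⟨l.length, m.length, h, ?_, ?_⟩
  · have hmem (w : PrimeSpectrum.comap (algebraMap Γ(Y, V) Γ(X, U)) ⁻¹'
        {hV.primeIdealOf ⟨f z, hzV⟩}) : f (hU.fromSpec w.1) = f z :=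
      hV.apply_fromSpec_of_comap_appLE_eq hU f hUV hzV w.2
    refine l.length_le_localDim (fun w ↦ ⟨hU.fromSpec w.1, hmem w⟩) (fun v w ↦ ?_) ?_
    · rw [subtype_specializes_iff]
      exact hU.fromSpec_specializes_iff
    · rw [subtype_specializes_iff]
      have := hU.fromSpec_specializes_iff.mpr hl
      rwa [hU.fromSpec_primeIdealOf] at this
  · refine m.length_le_localDim hV.fromSpec (fun _ _ ↦ hV.fromSpec_specializes_iff) ?_
    have := hV.fromSpec_specializes_iff.mpr hm
    rwa [hV.fromSpec_primeIdealOf] at this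

end AlgebraicGeometry

/-- For a morphism `f : X ⟶ Y` of schemes of finite type over an algebraically closed
field `k`, and any point `z` of `X`, one has
`dim_z X − dim_{f z} Y ≤ dim_z f⁻¹(f z)`, written additively as
`dim_z X ≤ dim_z f⁻¹(f z) + dim_{f z} Y`. -/
theorem statement0 {k : Type} [Field k] [IsAlgClosed k]
    (X Y : Scheme) (f : X ⟶ Y)
    (sX : X ⟶ Spec (CommRingCat.of k)) (sY : Y ⟶ Spec (CommRingCat.of k))
    [LocallyOfFiniteType sX] [LocallyOfFiniteType sY]
    [CompactSpace X] [CompactSpace Y]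
    (hcomm : f ≫ sY = sX) (z : X) :
    localDim X z ≤
      localDim (f.base ⁻¹' {f.base z} : Set X) ⟨z, rfl⟩ + localDim Y (f.base z) := by
  subst hcomm
  refine iSup₂_le fun C hC ↦ ?_
  have hx := hC.1.1.isGenericPoint_genericPoint (isClosed_of_mem_irreducibleComponents C hC.1)
  obtain ⟨N, M, h, hN, hM⟩ := f.exists_residueTrdeg_le_of_specializes sY (hx.specializes hC.2)
  refine ((f ≫ sY).topologicalKrullDim_le_residueTrdeg hx h).trans ?_
  push_cast
  exact add_le_add hN hM
end

section
/- Let f : X → Y be an open morphism of schemes of finite type over an algebraically closed field k. Then for every z ∈ X one has dim_z(X) − dim_{f(z)}(Y) = dim_z(f⁻¹(f(z))). -/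
open AlgebraicGeometry CategoryTheory Topology

universe u

/-- The transcendence degree as a natural number. -/
noncomputable def natTrdeg (K A : Type*) [CommRing K] [CommRing A] [Algebra K A] : ℕ :=
  Cardinal.toNat (Algebra.trdeg K A)

section trdeg

variable {K : Type u} [Field K]

lemma natTrdeg_le_of_injective {A B : Type u} [CommRing A] [CommRing B] [Algebra K A]
    [Algebra K B] [Algebra.FiniteType K B] (f : A →ₐ[K] B) (hf : Function.Injective f) :
    natTrdeg K A ≤ natTrdeg K B :=
  Cardinal.toNat_le_toNat (trdeg_le_of_injective f hf)
    (trdeg_lt_aleph0_of_finiteType (R := K) (S := B))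

lemma natTrdeg_eq_of_algEquiv {A B : Type u} [CommRing A] [CommRing B] [Algebra K A]
    [Algebra K B] (e : A ≃ₐ[K] B) : natTrdeg K A = natTrdeg K B :=
  congrArg Cardinal.toNat e.trdeg_eq

lemma natTrdeg_eq_of_isAlgebraic {A B : Type u} [CommRing A] [CommRing B] [IsDomain B]
    [Algebra K A] [Algebra K B] [Algebra A B] [IsScalarTower K A B] [FaithfulSMul A B]
    [Algebra.IsAlgebraic A B] : natTrdeg K A = natTrdeg K B := by
  have : IsDomain A := (FaithfulSMul.algebraMap_injective A B).isDomain
  unfold natTrdeg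
  rw [← trdeg_add_eq K A (A := B), trdeg_eq_zero (R := A), add_zero]

lemma natTrdeg_mvPolynomial (n : ℕ) :
    natTrdeg K (MvPolynomial (Fin n) K) = n := by
  simp [natTrdeg, MvPolynomial.trdeg_of_isDomain]

lemma natTrdeg_mvPolynomial_quotient_lt {n : ℕ} (q : Ideal (MvPolynomial (Fin n) K)) [q.IsPrime]
    (hq : q ≠ ⊥) : natTrdeg K (MvPolynomial (Fin n) K ⧸ q) < n := by
  by_contra! h
  have hlt := trdeg_lt_aleph0_of_finiteType (R := K) (S := MvPolynomial (Fin n) K ⧸ q)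
  let x : Fin n → MvPolynomial (Fin n) K ⧸ q := fun i ↦ Ideal.Quotient.mk q (MvPolynomial.X i)
  have hx : (MvPolynomial.aeval x : _ →ₐ[K] _) = Ideal.Quotient.mkₐ K q := by
    ext i; simp [x]
  have htop : Algebra.adjoin K (Set.range x) = ⊤ := by
    rw [Algebra.adjoin_range_eq_range_aeval, hx, AlgHom.range_eq_top]
    exact Ideal.Quotient.mk_surjective
  have : Algebra.IsAlgebraic (Algebra.adjoin K (Set.range x)) (MvPolynomial (Fin n) K ⧸ q) := by
    refine ⟨fun y ↦ ?_⟩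
    have hy : y ∈ Algebra.adjoin K (Set.range x) := htop ▸ Algebra.mem_top
    exact isAlgebraic_algebraMap (⟨y, hy⟩ : Algebra.adjoin K (Set.range x))
  have hb := Algebra.IsAlgebraic.isTranscendenceBasis_of_lift_le_trdeg_of_finite
    K x (by
      rw [← Cardinal.toNat_le_iff_le_of_lt_aleph0 (by simp) (by simpa using hlt)]
      simpa [natTrdeg] using h)
  have hinj : Function.Injective (MvPolynomial.aeval x : _ →ₐ[K] _) := hb.1
  rw [hx] at hinj
  apply hq
  rw [eq_bot_iff]
  intro a ha
  exact hinj (by simpa [Ideal.Quotient.eq_zero_iff_mem] using ha)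

lemma le_natTrdeg_mvPolynomial_quotient_span {n : ℕ} (f : MvPolynomial (Fin n) K)
    (hf : Prime f) : n ≤ natTrdeg K (MvPolynomial (Fin n) K ⧸ Ideal.span {f}) + 1 := by
  have : (Ideal.span {f}).IsPrime := by rwa [Ideal.span_singleton_prime hf.ne_zero]
  have hlt := trdeg_lt_aleph0_of_finiteType (R := K)
    (S := MvPolynomial (Fin n) K ⧸ Ideal.span {f})
  obtain ⟨i, hi⟩ : ∃ i, f.degreeOf i ≠ 0 := by
    by_contra! h
    have hC : f = MvPolynomial.C (f.coeff 0) := by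
      apply MvPolynomial.totalDegree_eq_zero_iff_eq_C.mp
      rw [MvPolynomial.totalDegree_eq_zero_iff]
      intro m hm i
      have := MvPolynomial.monomial_le_degreeOf i hm
      rw [h i] at this
      omega
    apply hf.not_isUnit
    have h0 : f.coeff 0 ≠ 0 := by
      intro h0
      rw [h0, map_zero] at hC
      exact hf.ne_zero hC
    rw [hC]
    exact (IsUnit.mk0 _ h0).map MvPolynomial.C
  let x : {j // j ≠ i} → MvPolynomial (Fin n) K ⧸ Ideal.span {f} :=
    fun j ↦ Ideal.Quotient.mk _ (MvPolynomial.X j.1)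
  have hx : AlgebraicIndependent K x := by
    rw [algebraicIndependent_iff]
    intro p hp
    have he : MvPolynomial.aeval x p =
        Ideal.Quotient.mk (Ideal.span {f}) (MvPolynomial.rename Subtype.val p) := by
      change _ = (Ideal.Quotient.mkₐ K (Ideal.span {f})) (MvPolynomial.rename Subtype.val p)
      rw [← AlgHom.comp_apply]
      congr 1
      ext j; simp [x]
    rw [he, Ideal.Quotient.eq_zero_iff_mem, Ideal.mem_span_singleton] at hp
    obtain ⟨g, hg⟩ := hp
    by_contra hp0
    have hr0 : MvPolynomial.rename Subtype.val p ≠ 0 := fun h ↦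
      hp0 (MvPolynomial.rename_injective _ Subtype.val_injective (by simpa using h))
    have hg0 : g ≠ 0 := by rintro rfl; simp [hr0] at hg
    have h1 : (MvPolynomial.rename Subtype.val p).degreeOf i = 0 := by
      classical
      by_contra hne
      have : i ∈ (MvPolynomial.rename (Subtype.val : {j // j ≠ i} → Fin n) p).vars := by
        rw [MvPolynomial.vars_def, Multiset.mem_toFinset, ← Multiset.one_le_count_iff_mem,
          ← MvPolynomial.degreeOf_def]
        omega
      obtain ⟨j, -, hj⟩ := Finset.mem_image.mp (MvPolynomial.vars_rename _ _ this)
      exact j.2 hj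
    rw [hg, MvPolynomial.degreeOf_mul_eq hf.ne_zero hg0] at h1
    omega
  have hc := hx.lift_cardinalMk_le_trdeg
  have := Cardinal.toNat_le_toNat hc (by simpa using hlt)
  simp at this
  unfold natTrdeg
  omega

lemma exists_noether_normalization (K D : Type u) [Field K] [CommRing D] [IsDomain D]
    [Algebra K D] [Algebra.FiniteType K D] : ∃ (n : ℕ) (_ : Algebra (MvPolynomial (Fin n) K) D),
      IsScalarTower K (MvPolynomial (Fin n) K) D ∧ FaithfulSMul (MvPolynomial (Fin n) K) D ∧
      Algebra.IsIntegral (MvPolynomial (Fin n) K) D := by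
  obtain ⟨n, g, hg, hi⟩ := exists_integral_inj_algHom_of_fg K D
  let := g.toRingHom.toAlgebra
  refine ⟨n, this, .of_algebraMap_eq fun x ↦ (g.commutes x).symm, ?_, ⟨hi⟩⟩
  exact (faithfulSMul_iff_algebraMap_injective _ _).mpr hg

lemma natTrdeg_quotient_lt {D : Type u} [CommRing D] [IsDomain D] [Algebra K D]
    [Algebra.FiniteType K D] (Q : Ideal D) [Q.IsPrime] (hQ : Q ≠ ⊥) :
    natTrdeg K (D ⧸ Q) < natTrdeg K D := by
  obtain ⟨n, _, _, _, _⟩ := exists_noether_normalization K D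
  rw [← natTrdeg_eq_of_isAlgebraic (K := K) (A := MvPolynomial (Fin n) K) (B := D),
    natTrdeg_mvPolynomial, ← natTrdeg_eq_of_isAlgebraic (K := K)
      (A := MvPolynomial (Fin n) K ⧸ Q.under (MvPolynomial (Fin n) K)) (B := D ⧸ Q)]
  exact natTrdeg_mvPolynomial_quotient_lt _ (mt Ideal.eq_bot_of_comap_eq_bot hQ)

lemma natTrdeg_le_quotient_add_one {D : Type u} [CommRing D] [IsDomain D] [Algebra K D]
    [Algebra.FiniteType K D] (Q : Ideal D) [Q.IsPrime] (hQ : Q.height = 1) :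
    natTrdeg K D ≤ natTrdeg K (D ⧸ Q) + 1 := by
  obtain ⟨n, _, _, _, _⟩ := exists_noether_normalization K D
  have : IsNoetherianRing D := Algebra.FiniteType.isNoetherianRing K D
  rw [← natTrdeg_eq_of_isAlgebraic (K := K) (A := MvPolynomial (Fin n) K) (B := D),
    natTrdeg_mvPolynomial, ← natTrdeg_eq_of_isAlgebraic (K := K)
      (A := MvPolynomial (Fin n) K ⧸ Q.under (MvPolynomial (Fin n) K)) (B := D ⧸ Q)]
  set q := Q.under (MvPolynomial (Fin n) K) with hq
  have h0 : q ≠ ⊥ := mt Ideal.eq_bot_of_comap_eq_bot (Ideal.ne_bot_of_height_eq_one hQ)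
  have h1 : q.height = 1 := by
    apply le_antisymm
    · rw [← hQ, Ideal.height_eq_height_add_of_liesOver_of_hasGoingDown q Q]
      exact le_self_add
    · rw [Order.one_le_iff_ne_zero, ne_eq, Ideal.height_eq_zero_iff_eq_bot]
      exact h0
  obtain ⟨f, hf, hfp⟩ := Ideal.IsPrime.exists_mem_prime_of_ne_bot (I := q) inferInstance h0
  rw [Ideal.eq_span_singleton_of_height_eq_one h1 hf hfp]
  exact le_natTrdeg_mvPolynomial_quotient_span f hfp

end trdeg

section primes

variable {K : Type u} [Field K] {A : Type u} [CommRing A] [Algebra K A]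

lemma natTrdeg_quotient_comap {B : Type u} [CommRing B] [Algebra K B] (f : A →ₐ[K] B)
    (hf : Function.Surjective f) (Q : Ideal B) :
    natTrdeg K (A ⧸ Q.comap f) = natTrdeg K (B ⧸ Q) := by
  let g : A ⧸ Q.comap f →ₐ[K] B ⧸ Q := Ideal.quotientMapₐ Q f le_rfl
  exact natTrdeg_eq_of_algEquiv (AlgEquiv.ofBijective g
    ⟨Ideal.quotientMap_injective, Ideal.quotientMap_surjective (H := le_rfl) hf⟩)

lemma natTrdeg_quotient_eq_map {P Q : Ideal A} (h : P ≤ Q) :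
    natTrdeg K (A ⧸ Q) = natTrdeg K ((A ⧸ P) ⧸ Q.map (Ideal.Quotient.mk P)) := by
  rw [← natTrdeg_quotient_comap (Ideal.Quotient.mkₐ K P) (Ideal.Quotient.mkₐ_surjective K P)]
  have : (Q.map (Ideal.Quotient.mk P)).comap (Ideal.Quotient.mkₐ K P) = Q := by
    change (Q.map (Ideal.Quotient.mk P)).comap (Ideal.Quotient.mk P) = Q
    rw [Ideal.comap_map_of_surjective _ Ideal.Quotient.mk_surjective, ← RingHom.ker_eq_comap_bot,
      Ideal.mk_ker, sup_eq_left.mpr h]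
  rw [this]

variable [Algebra.FiniteType K A]

lemma natTrdeg_quotient_lt_of_lt {P Q : Ideal A} [P.IsPrime] [Q.IsPrime] (h : P < Q) :
    natTrdeg K (A ⧸ Q) < natTrdeg K (A ⧸ P) := by
  rw [natTrdeg_quotient_eq_map h.le]
  have := Ideal.isPrime_map_quotientMk_of_isPrime h.le
  apply natTrdeg_quotient_lt
  rw [ne_eq, Ideal.map_eq_bot_iff_le_ker, Ideal.mk_ker]
  exact h.not_ge

lemma exists_isPrime_natTrdeg_eq_add_one {P Q : Ideal A} [P.IsPrime] [Q.IsPrime] (h : P < Q) :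
    ∃ W : Ideal A, W.IsPrime ∧ P ≤ W ∧ W < Q ∧
      natTrdeg K (A ⧸ W) = natTrdeg K (A ⧸ Q) + 1 := by
  have : IsNoetherianRing A := Algebra.FiniteType.isNoetherianRing K A
  obtain ⟨W, ⟨hW, hPW, hWQ⟩, hmax⟩ := set_has_maximal_iff_noetherian.mpr ‹IsNoetherianRing A›
    {W : Ideal A | W.IsPrime ∧ P ≤ W ∧ W < Q} ⟨P, ‹_›, le_rfl, h⟩
  refine ⟨W, hW, hPW, hWQ, le_antisymm ?_ (natTrdeg_quotient_lt_of_lt hWQ)⟩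
  have := Ideal.isPrime_map_quotientMk_of_isPrime hWQ.le
  rw [natTrdeg_quotient_eq_map hWQ.le]
  apply natTrdeg_le_quotient_add_one
  apply le_antisymm
  · rw [← Nat.cast_one, Ideal.height_le_iff]
    intro J hJ hlt
    suffices J = ⊥ by simp [Ideal.height_eq_zero_iff_eq_bot.mpr this]
    have hWJ : W ≤ J.comap (Ideal.Quotient.mk W) := by
      intro x hx
      simp [Ideal.mem_comap, Ideal.Quotient.eq_zero_iff_mem.mpr hx]
    have hJQ : J.comap (Ideal.Quotient.mk W) < Q := by
      have := (Ideal.orderEmbeddingOfSurjective _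
        (Ideal.Quotient.mk_surjective (I := W))).strictMono hlt
      change J.comap _ < (Ideal.map _ Q).comap _ at this
      rwa [Ideal.comap_map_mk hWQ.le] at this
    have heq := hmax _ ⟨hJ.comap _, hPW.trans hWJ, hJQ⟩
    have : J.comap (Ideal.Quotient.mk W) = W := by
      by_contra hne
      exact heq (lt_of_le_of_ne hWJ (Ne.symm hne))
    rw [← Ideal.map_comap_of_surjective _ Ideal.Quotient.mk_surjective J, this,
      Ideal.map_quotient_self]
  · rw [Order.one_le_iff_ne_zero, ne_eq, Ideal.height_eq_zero_iff_eq_bot,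
      Ideal.map_eq_bot_iff_le_ker, Ideal.mk_ker]
    exact hWQ.not_ge

end primes

section fibres

variable {K : Type u} [Field K]

lemma exists_le_height_add_natTrdeg_le {A : Type u} [CommRing A] [Algebra K A]
    [Algebra.FiniteType K A] (Q : Ideal A) [Q.IsPrime] :
    ∃ η : Ideal A, η.IsPrime ∧ η ≤ Q ∧
      Q.height + (natTrdeg K (A ⧸ Q) : ℕ∞) ≤ (natTrdeg K (A ⧸ η) : ℕ∞) := by
  have : IsNoetherianRing A := Algebra.FiniteType.isNoetherianRing K A
  obtain ⟨l, hl, hlen⟩ := Ideal.exists_ltSeries_length_eq_height Q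
  let g : Fin (l.length + 1) → ℕ := fun i ↦ natTrdeg K (A ⧸ (l i).asIdeal)
  have hg : StrictAnti g := fun i j hij ↦
    natTrdeg_quotient_lt_of_lt (K := K) (PrimeSpectrum.asIdeal_lt_asIdeal _ _ |>.mpr
      (l.strictMono hij))
  have hind : ∀ i : ℕ, ∀ hi : i < l.length + 1, i + g ⟨i, hi⟩ ≤ g 0 := by
    intro i
    induction i with
    | zero => intro hi; simp
    | succ i ih =>
      intro hi
      have h1 := ih (by omega)
      have h2 : g ⟨i + 1, hi⟩ < g ⟨i, by omega⟩ := hg (by simp)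
      omega
  refine ⟨l.head.asIdeal, inferInstance, ?_, ?_⟩
  · have : l.head ≤ l.last := l.head_le_last
    rw [hl] at this
    exact this
  · rw [← hlen]
    have h1 := hind l.length (by omega)
    have h2 : g ⟨l.length, by omega⟩ = natTrdeg K (A ⧸ Q) := by
      change natTrdeg K (A ⧸ l.last.asIdeal) = _
      rw [hl]
    rw [h2] at h1
    exact_mod_cast h1

lemma natTrdeg_quotient_le_add_height {A : Type u} [CommRing A] [Algebra K A]
    [Algebra.FiniteType K A] {P Q : Ideal A} [P.IsPrime] [Q.IsPrime] (h : P ≤ Q) :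
    (natTrdeg K (A ⧸ P) : ℕ∞) ≤ natTrdeg K (A ⧸ Q) + Q.height := by
  obtain ⟨n, hn⟩ : ∃ n, n = natTrdeg K (A ⧸ P) - natTrdeg K (A ⧸ Q) := ⟨_, rfl⟩
  induction n generalizing Q with
  | zero => exact le_add_right (by exact_mod_cast Nat.sub_eq_zero_iff_le.mp hn.symm)
  | succ n ih =>
    have hlt : P < Q := lt_of_le_of_ne h (by rintro rfl; simp at hn)
    obtain ⟨W, hW, hPW, hWQ, hd⟩ := exists_isPrime_natTrdeg_eq_add_one (K := K) hlt
    refine (ih hPW (by omega)).trans ?_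
    rw [hd, Nat.cast_add, Nat.cast_one, add_assoc, add_comm (1 : ℕ∞)]
    gcongr
    exact Ideal.height_add_one_le_of_lt_of_isPrime hWQ

variable {A B : Type u} [CommRing A] [CommRing B] [Algebra K A] [Algebra K B] [Algebra A B]
  [Algebra.FiniteType K B]

lemma natTrdeg_quotient_le_of_liesOver [IsScalarTower K A B] (q : Ideal A) (P : Ideal B)
    [P.LiesOver q] :
    natTrdeg K (A ⧸ q) ≤ natTrdeg K (B ⧸ P) :=
  natTrdeg_le_of_injective (IsScalarTower.toAlgHom K (A ⧸ q) (B ⧸ P))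
    (FaithfulSMul.algebraMap_injective _ _)

variable [Algebra.FiniteType K A]

lemma exists_natTrdeg_add_le (q : Ideal A) [q.IsPrime] {P Q : Ideal B} [P.IsPrime] [Q.IsPrime]
    [Q.LiesOver q] (h : P ≤ Q) :
    ∃ (η : Ideal B) (ζ : Ideal A), η.IsPrime ∧ ζ.IsPrime ∧ η.LiesOver q ∧ η ≤ Q ∧ ζ ≤ q ∧
      natTrdeg K (B ⧸ P) + natTrdeg K (A ⧸ q) ≤
        natTrdeg K (B ⧸ η) + natTrdeg K (A ⧸ ζ) := by
  have : IsNoetherianRing A := Algebra.FiniteType.isNoetherianRing K A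
  have : IsNoetherianRing B := Algebra.FiniteType.isNoetherianRing K B
  have h1 := natTrdeg_quotient_le_add_height (K := K) h
  have h2 := Ideal.height_le_height_add_of_liesOver q Q
  obtain ⟨ζ, hζ, hζq, h3⟩ := exists_le_height_add_natTrdeg_le (K := K) q
  set J := q.map (algebraMap A B)
  have hJQ : J ≤ Q := Ideal.map_le_iff_le_comap.mpr (Ideal.LiesOver.over (P := Q) (p := q)).le
  have := Ideal.isPrime_map_quotientMk_of_isPrime hJQ
  obtain ⟨η', hη', hηQ, h4⟩ := exists_le_height_add_natTrdeg_le (K := K)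
    (Q.map (Ideal.Quotient.mk J))
  rw [← natTrdeg_quotient_eq_map hJQ] at h4
  have hle : η'.comap (Ideal.Quotient.mk J) ≤ Q := by
    rw [← Ideal.comap_map_mk hJQ]
    exact Ideal.comap_mono hηQ
  have hd : natTrdeg K (B ⧸ η'.comap (Ideal.Quotient.mk J)) = natTrdeg K ((B ⧸ J) ⧸ η') :=
    natTrdeg_quotient_comap (Ideal.Quotient.mkₐ K J) (Ideal.Quotient.mkₐ_surjective K J) η'
  refine ⟨η'.comap (Ideal.Quotient.mk J), ζ, inferInstance, hζ, ⟨le_antisymm ?_ ?_⟩, hle, hζq, ?_⟩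
  · intro x hx
    simp only [Ideal.under, Ideal.mem_comap]
    rw [Ideal.Quotient.eq_zero_iff_mem.mpr (Ideal.mem_map_of_mem _ hx)]
    exact zero_mem _
  · rw [Ideal.LiesOver.over (P := Q) (p := q)]
    exact Ideal.comap_mono hle
  · rw [hd, ← ENat.natCast_le_natCast]
    push_cast
    calc _ ≤ (natTrdeg K (B ⧸ Q) + (q.height + (Q.map (Ideal.Quotient.mk J)).height) +
            natTrdeg K (A ⧸ q) : ℕ∞) := by
          gcongr
          exact h1.trans (by gcongr)
      _ = ((Q.map (Ideal.Quotient.mk J)).height + natTrdeg K (B ⧸ Q)) +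
            (q.height + natTrdeg K (A ⧸ q)) := by ring
      _ ≤ _ := by gcongr

lemma exists_liesOver_natTrdeg_eq [IsScalarTower K A B] (q : Ideal A) [q.IsPrime] (P : Ideal B)
    [P.IsPrime] [P.LiesOver q] : ∃ P' : Ideal B, P'.IsPrime ∧ P'.LiesOver q ∧ P ≤ P' ∧
      natTrdeg K (B ⧸ P') = natTrdeg K (A ⧸ q) := by
  let ι : B →ₐ[A] q.Fiber B := Algebra.TensorProduct.includeRight
  have : Algebra.FiniteType A B := .of_restrictScalars_finiteType K A B
  have : Algebra.FiniteType q.ResidueField (q.Fiber B) := .baseChange _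
  let P₀ : PrimeSpectrum (q.Fiber B) :=
    PrimeSpectrum.primesOverOrderIsoFiber A B q ⟨P, ‹_›, ‹_›⟩
  have hP₀ : P₀.asIdeal.comap ι = P :=
    congr($((PrimeSpectrum.primesOverOrderIsoFiber A B q).symm_apply_apply ⟨P, ‹_›, ‹_›⟩).1)
  obtain ⟨m, hm, hle⟩ := Ideal.exists_le_maximal P₀.asIdeal P₀.2.ne_top
  let P' : Ideal B := m.comap ι
  have hP' : P'.LiesOver q := by
    refine ⟨(Ideal.LiesOver.over (P := m) (p := q)).trans ?_⟩
    ext x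
    simp [P', Ideal.mem_comap]
  let := Ideal.Quotient.field m
  have : Algebra.FiniteType q.ResidueField (q.Fiber B ⧸ m) :=
    .of_surjective (Ideal.Quotient.mkₐ q.ResidueField m) (Ideal.Quotient.mkₐ_surjective _ _)
  have : FaithfulSMul q.ResidueField (q.Fiber B ⧸ m) :=
    (faithfulSMul_iff_algebraMap_injective _ _).mpr (RingHom.injective _)
  have : Module.Finite q.ResidueField (q.Fiber B ⧸ m) :=
    finite_of_finite_type_of_isJacobsonRing _ _
  have h1 : Algebra.trdeg K (A ⧸ q) = Algebra.trdeg K q.ResidueField := by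
    rw [← trdeg_add_eq K (A ⧸ q) (A := q.ResidueField), trdeg_eq_zero (R := A ⧸ q), add_zero]
  have h2 : Algebra.trdeg K q.ResidueField = Algebra.trdeg K (q.Fiber B ⧸ m) := by
    rw [← trdeg_add_eq K q.ResidueField (A := q.Fiber B ⧸ m), trdeg_eq_zero (R := q.ResidueField),
      add_zero]
  refine ⟨P', inferInstance, hP', hP₀.symm.le.trans (Ideal.comap_mono hle),
    le_antisymm ?_ (natTrdeg_quotient_le_of_liesOver q P')⟩
  let g' : B ⧸ P' →ₐ[K] q.Fiber B ⧸ m := Ideal.quotientMapₐ m (ι.restrictScalars K) le_rfl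
  have hg' : Function.Injective g' := Ideal.quotientMap_injective
  unfold natTrdeg
  refine Cardinal.toNat_le_toNat ?_ (trdeg_lt_aleph0_of_finiteType (R := K) (S := A ⧸ q))
  rw [h1, h2]
  exact trdeg_le_of_injective g' hg'

end fibres

open TopologicalSpace in
/-- An open map with sober fibres out of a Noetherian space lifts generizations. -/
lemma IsOpenMap.exists_specializes {T S : Type*} [TopologicalSpace T] [TopologicalSpace S]
    [NoetherianSpace T] {f : T → S} (hf : IsOpenMap f) (hq : ∀ y, QuasiSober (f ⁻¹' {y} : Set T))
    {x : T} {w : S} (hw : w ⤳ f x) : ∃ x', x' ⤳ x ∧ f x' = w := by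
  have hx : x ∈ closure (f ⁻¹' {w}) := by
    rw [mem_closure_iff]
    intro U hU hxU
    obtain ⟨u, hu, rfl⟩ := hw.mem_open (hf U hU) ⟨x, hxU, rfl⟩
    exact ⟨u, hu, rfl⟩
  have hcov : f ⁻¹' {w} = ⋃ C ∈ irreducibleComponents (f ⁻¹' {w} : Set T), Subtype.val '' C := by
    rw [← Set.image_iUnion₂, ← Set.sUnion_eq_biUnion, sUnion_irreducibleComponents,
      Set.image_univ, Subtype.range_coe]
  have : NoetherianSpace (f ⁻¹' {w} : Set T) := IsInducing.subtypeVal.noetherianSpace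
  rw [hcov, NoetherianSpace.finite_irreducibleComponents.closure_biUnion, Set.mem_iUnion₂] at hx
  obtain ⟨C, hC, hx⟩ := hx
  have := hq w
  obtain ⟨g, hg⟩ := QuasiSober.sober hC.1 (isClosed_of_mem_irreducibleComponents C hC)
  obtain rfl : closure {g} = C := hg
  refine ⟨g, specializes_iff_mem_closure.mpr ?_, g.2⟩
  have h1 := image_closure_subset_closure_image (s := {g})
    (continuous_subtype_val (p := (· ∈ f ⁻¹' {w})))
  rw [Set.image_singleton] at h1
  exact closure_minimal h1 isClosed_closure hx

/-- A dimension function on a topological space: it drops strictly under proper specializations,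
each drop can be refined by steps of size one, and every point specializes to one where it
vanishes. -/
structure IsDimensionFunction {T : Type*} [TopologicalSpace T] (δ : T → ℕ) : Prop where
  lt_of_specializes : ∀ {x x' : T}, x ⤳ x' → x ≠ x' → δ x' < δ x
  exists_eq_add_one : ∀ {x x' : T}, x ⤳ x' → x ≠ x' → ∃ w, x ⤳ w ∧ w ⤳ x' ∧ δ w = δ x' + 1
  exists_eq_zero : ∀ x : T, ∃ x', x ⤳ x' ∧ δ x' = 0

namespace IsDimensionFunction

variable {T : Type*} [TopologicalSpace T] {δ : T → ℕ}

lemma le_of_specializes (h : IsDimensionFunction δ) {x x' : T} (hx : x ⤳ x') : δ x' ≤ δ x := by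
  by_cases hxx : x = x'
  · rw [hxx]
  · exact (h.lt_of_specializes hx hxx).le

lemma topologicalKrullDim_eq [QuasiSober T] [T0Space T] (h : IsDimensionFunction δ) :
    topologicalKrullDim T = ⨆ x, ((δ x : ℕ∞) : WithBot ℕ∞) := by
  let := specializationOrder T
  have hlt : ∀ {x x' : T}, x' < x ↔ x ⤳ x' ∧ x ≠ x' := fun {x x'} ↦ by
    rw [lt_iff_le_and_ne, ne_comm]; rfl
  have hmono : StrictMono δ := fun x x' hx ↦ by
    obtain ⟨h1, h2⟩ := hlt.mp hx
    exact h.lt_of_specializes h1 h2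
  have hle (x : T) : Order.height x ≤ δ x := by
    simpa using Order.height_le_height_apply_of_strictMono δ hmono x
  have hge (x : T) (n : ℕ) : n ≤ δ x → ∃ w, x ⤳ w ∧ δ w = n ∧ n ≤ Order.height w := by
    induction n with
    | zero =>
      obtain ⟨w, hw, hw'⟩ := h.exists_eq_zero x
      exact fun _ ↦ ⟨w, hw, hw', by simp⟩
    | succ n ih =>
      intro hn
      obtain ⟨w, hw, hw', hh⟩ := ih (by omega)
      obtain ⟨v, hv, hvw, hv'⟩ := h.exists_eq_add_one hw (by rintro rfl; omega)
      refine ⟨v, hv, by omega, ?_⟩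
      have : w < v := hlt.mpr ⟨hvw, by rintro rfl; omega⟩
      push_cast
      exact (by gcongr : _ ≤ Order.height w + 1).trans (Order.height_add_one_le this)
  rw [topologicalKrullDim, Order.krullDim_eq_of_orderIso (irreducibleSetEquivPoints (α := T)),
    Order.krullDim_eq_iSup_height]
  refine le_antisymm (iSup_mono fun x ↦ by exact_mod_cast hle x) (iSup_le fun x ↦ ?_)
  obtain ⟨w, -, -, hw⟩ := hge x (δ x) le_rfl
  exact le_iSup_of_le w (by exact_mod_cast hw)

lemma restrict_closure (h : IsDimensionFunction δ) (x : T) :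
    IsDimensionFunction (fun y : closure {x} ↦ δ y) where
  lt_of_specializes hy hne :=
    h.lt_of_specializes ((subtype_specializes_iff _ _).mp hy) (Subtype.coe_ne_coe.mpr hne)
  exists_eq_add_one {y y'} hy hne := by
    obtain ⟨w, hw, hw', he⟩ := h.exists_eq_add_one ((subtype_specializes_iff _ _).mp hy)
      (Subtype.coe_ne_coe.mpr hne)
    exact ⟨⟨w, (specializes_iff_mem_closure.mp
      ((specializes_iff_mem_closure.mpr y.2).trans hw))⟩, (subtype_specializes_iff _ _).mpr hw,
      (subtype_specializes_iff _ _).mpr hw', he⟩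
  exists_eq_zero y := by
    obtain ⟨w, hw, he⟩ := h.exists_eq_zero y
    exact ⟨⟨w, (specializes_iff_mem_closure.mp
      ((specializes_iff_mem_closure.mpr y.2).trans hw))⟩, (subtype_specializes_iff _ _).mpr hw, he⟩

lemma topologicalKrullDim_closure [QuasiSober T] [T0Space T] (h : IsDimensionFunction δ) (x : T) :
    topologicalKrullDim (closure {x}) = ((δ x : ℕ∞) : WithBot ℕ∞) := by
  have : QuasiSober (closure {x}) := isClosed_closure.isClosedEmbedding_subtypeVal.quasiSober
  rw [(h.restrict_closure x).topologicalKrullDim_eq]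
  refine le_antisymm (iSup_le fun y ↦ ?_)
    (le_iSup_of_le ⟨x, subset_closure rfl⟩ le_rfl)
  exact_mod_cast h.le_of_specializes (specializes_iff_mem_closure.mpr y.2)

lemma localDim_eq [QuasiSober T] [T0Space T] (h : IsDimensionFunction δ) (z : T) :
    localDim T z = ((⨆ x : {x // x ⤳ z}, (δ x : ℕ∞) : ℕ∞) : WithBot ℕ∞) := by
  have : Nonempty {x // x ⤳ z} := ⟨z, specializes_rfl⟩
  rw [WithBot.coe_iSup (OrderTop.bddAbove _), localDim]
  apply le_antisymm
  · refine iSup₂_le fun C hC ↦ ?_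
    obtain ⟨x, hx⟩ := QuasiSober.sober hC.1.1
      (isClosed_of_mem_irreducibleComponents C hC.1)
    obtain rfl : closure {x} = C := hx
    rw [h.topologicalKrullDim_closure]
    exact le_iSup_of_le ⟨x, specializes_iff_mem_closure.mpr hC.2⟩ le_rfl
  · refine iSup_le fun x ↦ ?_
    obtain ⟨C, hC, hxC⟩ := exists_mem_irreducibleComponents_subset_of_isIrreducible (closure {x.1})
      isIrreducible_singleton.closure
    have hzC : z ∈ C := hxC (specializes_iff_mem_closure.mp x.2)
    obtain ⟨y, hy⟩ := QuasiSober.sober hC.1 (isClosed_of_mem_irreducibleComponents C hC)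
    obtain rfl : closure {y} = C := hy
    refine le_iSup₂_of_le (closure {y}) ⟨hC, hzC⟩ ?_
    rw [h.topologicalKrullDim_closure]
    exact_mod_cast h.le_of_specializes
      (specializes_iff_mem_closure.mpr (hxC (subset_closure rfl)))

/-- Local dimensions are additive along an open map `f` whose source and target carry dimension
functions `δ` and `ε` such that `δ` attains its lower bound `ε` on every fibre, and its growth
under generization is bounded by the growth along the fibre plus that of `ε` on the base. -/
lemma localDim_add {S : Type*} [TopologicalSpace S] [QuasiSober T] [T0Space T] [QuasiSober S]
    [T0Space S] {ε : S → ℕ} (hδ : IsDimensionFunction δ) (hε : IsDimensionFunction ε)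
    {f : T → S} (hf : IsOpenMap f) (hc : Continuous f) (z : T) [TopologicalSpace.NoetherianSpace T]
    (hq : ∀ y, QuasiSober (f ⁻¹' {y} : Set T))
    (hle : ∀ x, ε (f x) ≤ δ x)
    (hfib : ∀ x : T, ∃ x', x ⤳ x' ∧ f x' = f x ∧ δ x' = ε (f x))
    (hgen : ∀ x, x ⤳ z → ∃ η ζ, η ⤳ z ∧ f η = f z ∧ ζ ⤳ f z ∧ δ x + ε (f z) ≤ δ η + ε ζ) :
    localDim T z = localDim (f ⁻¹' {f z} : Set T) ⟨z, rfl⟩ + localDim S (f z) := by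
  have := hq (f z)
  have hfz (x : (f ⁻¹' {f z} : Set T)) : f x = f z := x.2
  have hφ : IsDimensionFunction (fun x : (f ⁻¹' {f z} : Set T) ↦ δ x - ε (f z)) := by
    constructor
    · intro x x' hx hne
      have h1 := hδ.lt_of_specializes ((subtype_specializes_iff _ _).mp hx)
        (Subtype.coe_ne_coe.mpr hne)
      have h2 := hle x'
      rw [hfz] at h2
      omega
    · intro x x' hx hne
      obtain ⟨w, hw, hw', he⟩ := hδ.exists_eq_add_one ((subtype_specializes_iff _ _).mp hx)
        (Subtype.coe_ne_coe.mpr hne)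
      have h2 := hle x'
      rw [hfz] at h2
      have hfw : f w = f z := by
        have h3 := hw.map hc
        have h4 := hw'.map hc
        rw [hfz] at h3 h4
        exact (h4.antisymm h3).eq
      exact ⟨⟨w, hfw⟩, (subtype_specializes_iff _ _).mpr hw, (subtype_specializes_iff _ _).mpr hw',
        by dsimp only; omega⟩
    · intro x
      obtain ⟨x', hx', hf', he⟩ := hfib x
      rw [hfz] at hf' he
      exact ⟨⟨x', hf'⟩, (subtype_specializes_iff _ _).mpr hx', by simp [he]⟩
  have : Nonempty {x : (f ⁻¹' {f z} : Set T) // x ⤳ ⟨z, rfl⟩} := ⟨⟨z, rfl⟩, specializes_rfl⟩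
  have : Nonempty {x : S // x ⤳ f z} := ⟨f z, specializes_rfl⟩
  rw [hδ.localDim_eq, hε.localDim_eq, hφ.localDim_eq, ← WithBot.coe_add, WithBot.coe_inj]
  apply le_antisymm
  · refine iSup_le fun x ↦ ?_
    obtain ⟨η, ζ, hη, hfη, hζ, h⟩ := hgen x x.2
    have h1 := hle η
    rw [hfη] at h1
    have h2 : δ x ≤ (δ η - ε (f z)) + ε ζ := by omega
    refine (Nat.cast_le.mpr h2).trans ?_
    rw [Nat.cast_add]
    exact add_le_add
      (le_iSup (fun x : {x : (f ⁻¹' {f z} : Set T) // x ⤳ ⟨z, rfl⟩} ↦ ((δ x - ε (f z) : ℕ) : ℕ∞))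
        ⟨⟨η, hfη⟩, (subtype_specializes_iff _ _).mpr hη⟩)
      (le_iSup (fun x : {x // x ⤳ f z} ↦ (ε x : ℕ∞)) ⟨ζ, hζ⟩)
  · refine ENat.iSup_add_iSup_le fun η ζ ↦ ?_
    have key (n : ℕ) : ∀ (y : S) (η : T), ζ.1 ⤳ y → f η = y → ε ζ - ε y = n →
        ∃ x, x ⤳ η ∧ δ η + n ≤ δ x := by
      induction n with
      | zero => exact fun y η _ _ _ ↦ ⟨η, specializes_rfl, le_rfl⟩
      | succ n ih =>
        intro y η hζ hη hn
        obtain ⟨w, hζw, hwy, hw⟩ := hε.exists_eq_add_one hζ (by rintro rfl; omega)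
        obtain ⟨x', hx', rfl⟩ := hf.exists_specializes hq (hη ▸ hwy)
        obtain ⟨x, hx, hxn⟩ := ih _ x' hζw rfl (by omega)
        have h1 := hδ.lt_of_specializes hx' (by rintro rfl; subst hη; omega)
        exact ⟨x, hx.trans hx', by omega⟩
    obtain ⟨x, hx, hxn⟩ := key _ (f z) η ζ.2 (hfz η) rfl
    have h1 := hle η
    rw [hfz] at h1
    have h2 := hε.le_of_specializes ζ.2
    refine le_iSup_of_le ⟨x, hx.trans ((subtype_specializes_iff _ _).mp η.2)⟩ ?_
    rw [← Nat.cast_add, Nat.cast_le]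
    dsimp only
    omega

end IsDimensionFunction

namespace AlgebraicGeometry

section charts

variable {k : Type u} [Field k]

/-- The transcendence degree over `k` of the residue field at a point of a `k`-scheme. -/
noncomputable def pointTrdeg {X : Scheme.{u}} (s : X ⟶ Spec (.of k)) (x : X) : ℕ :=
  letI : Algebra k (X.residueField x) :=
    (Spec.preimage (X.fromSpecResidueField x ≫ s)).hom.toAlgebra
  natTrdeg k (X.residueField x)

lemma natTrdeg_residueField {R : Type u} [CommRing R] [Algebra k R] (I : Ideal R) [I.IsPrime] :
    natTrdeg k I.ResidueField = natTrdeg k (R ⧸ I) :=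
  natTrdeg_eq_of_isAlgebraic.symm

lemma pointTrdeg_apply {X : Scheme.{u}} (s : X ⟶ Spec (.of k)) {R : Type u} [CommRing R]
    [Algebra k R] (ι : Spec (.of R) ⟶ X) [IsOpenImmersion ι]
    (h : Spec.map (CommRingCat.ofHom (algebraMap k R)) = ι ≫ s) (P : Spec (.of R)) :
    pointTrdeg s (ι P) = natTrdeg k (R ⧸ P.asIdeal) := by
  have : P.asIdeal.IsPrime := P.2
  let e : X.residueField (ι P) ≅ .of P.asIdeal.ResidueField :=
    asIso (ι.residueFieldMap P) ≪≫ Scheme.Spec.residueFieldIso (.of R) P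
  have he : Spec.preimage (X.fromSpecResidueField (ι P) ≫ s) ≫ e.hom =
      CommRingCat.ofHom (algebraMap k P.asIdeal.ResidueField) := by
    rw [← Iso.eq_comp_inv]
    apply Spec.map_injective
    have h1 : Spec.map (CommRingCat.ofHom (algebraMap k P.asIdeal.ResidueField)) =
        Spec.map (CommRingCat.ofHom (algebraMap R P.asIdeal.ResidueField)) ≫
          Spec.map (CommRingCat.ofHom (algebraMap k R)) := by
      rw [← Spec.map_comp, ← CommRingCat.ofHom_comp, ← IsScalarTower.algebraMap_eq]
    rw [Spec.map_comp, Spec.map_preimage, h1, h]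
    have h2 := Scheme.Spec.map_residueFieldIso_inv_eq_fromSpecResidueField (.of R) P
    have h3 := ι.SpecMap_residueFieldMap_fromSpecResidueField P
    simp only [e, Iso.trans_inv, asIso_inv, Spec.map_comp, Category.assoc]
    erw [reassoc_of% h2]
    rw [← reassoc_of% h3, ← Spec.map_comp_assoc]
    simp
  let : Algebra k (X.residueField (ι P)) :=
    (Spec.preimage (X.fromSpecResidueField (ι P) ≫ s)).hom.toAlgebra
  let g : X.residueField (ι P) ≃ₐ[k] P.asIdeal.ResidueField :=
    AlgEquiv.ofRingEquiv (f := e.commRingCatIsoToRingEquiv) fun x ↦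
      congr($(he).hom x)
  exact (natTrdeg_eq_of_algEquiv g).trans
    (natTrdeg_residueField (R := R) (PrimeSpectrum.asIdeal P))

lemma exists_affine_chart {X Y : Scheme.{u}} (f : X ⟶ Y) (sX : X ⟶ Spec (.of k))
    (sY : Y ⟶ Spec (.of k)) [LocallyOfFiniteType sX] [LocallyOfFiniteType sY]
    (h : f ≫ sY = sX) (x : X) :
    ∃ (A B : Type u) (_ : CommRing A) (_ : CommRing B) (_ : Algebra k A) (_ : Algebra k B)
      (_ : Algebra A B) (ιY : PrimeSpectrum A → Y) (ιX : PrimeSpectrum B → X),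
      IsScalarTower k A B ∧ Algebra.FiniteType k A ∧ Algebra.FiniteType k B ∧
      IsOpenEmbedding ιY ∧ IsOpenEmbedding ιX ∧
      (∀ P, pointTrdeg sY (ιY P) = natTrdeg k (A ⧸ P.asIdeal)) ∧
      (∀ P, pointTrdeg sX (ιX P) = natTrdeg k (B ⧸ P.asIdeal)) ∧
      (∀ P, f (ιX P) = ιY (PrimeSpectrum.comap (algebraMap A B) P)) ∧ x ∈ Set.range ιX := by
  obtain ⟨V, hV, hxV, -⟩ := exists_isAffineOpen_mem_and_subset (x := f x) (U := ⊤) trivial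
  obtain ⟨U, hU, hxU, hUV⟩ := exists_isAffineOpen_mem_and_subset (x := x) (U := f ⁻¹ᵁ V) hxV
  let φ : CommRingCat.of k ⟶ Γ(Y, V) := Spec.preimage (hV.fromSpec ≫ sY)
  let ψ : Γ(Y, V) ⟶ Γ(X, U) := f.appLE V U hUV
  have hφ : Spec.map φ = hV.fromSpec ≫ sY := Spec.map_preimage _
  have hψ : Spec.map ψ ≫ hV.fromSpec = hU.fromSpec ≫ f := hV.SpecMap_appLE_fromSpec f hU hUV
  have hφψ : Spec.map (φ ≫ ψ) = hU.fromSpec ≫ sX := by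
    rw [Spec.map_comp, hφ, reassoc_of% hψ, h]
  let := φ.hom.toAlgebra
  let := ψ.hom.toAlgebra
  let := (φ ≫ ψ).hom.toAlgebra
  refine ⟨Γ(Y, V), Γ(X, U), inferInstance, inferInstance, φ.hom.toAlgebra, (φ ≫ ψ).hom.toAlgebra,
    ψ.hom.toAlgebra, hV.fromSpec, hU.fromSpec, .of_algebraMap_eq fun _ ↦ rfl, ?_, ?_,
    hV.fromSpec.isOpenEmbedding, hU.fromSpec.isOpenEmbedding, fun P ↦ ?_, fun P ↦ ?_,
    fun P ↦ ?_, ?_⟩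
  · have : LocallyOfFiniteType (Spec.map φ) := hφ ▸ inferInstance
    exact (HasRingHomProperty.Spec_iff (P := @LocallyOfFiniteType)).mp this
  · have : LocallyOfFiniteType (Spec.map (φ ≫ ψ)) := hφψ ▸ inferInstance
    exact (HasRingHomProperty.Spec_iff (P := @LocallyOfFiniteType)).mp this
  · exact pointTrdeg_apply sY hV.fromSpec hφ P
  · exact pointTrdeg_apply sX hU.fromSpec hφψ P
  · exact congr($hψ P).symm
  · exact hU.range_fromSpec.symm ▸ hxU

lemma isDimensionFunction_pointTrdeg {X : Scheme.{u}} (s : X ⟶ Spec (.of k))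
    [LocallyOfFiniteType s] : IsDimensionFunction (pointTrdeg s) where
  lt_of_specializes {x x'} hx hne := by
    obtain ⟨-, B, -, _, -, _, -, -, ι, -, -, hB, -, hι', -, hι, -, Q, rfl⟩ :=
      exists_affine_chart (𝟙 X) s s (Category.id_comp s) x'
    obtain ⟨P, rfl⟩ := hx.mem_open hι'.isOpen_range ⟨Q, rfl⟩
    rw [hι, hι]
    have hPQ : P ≤ Q := (PrimeSpectrum.le_iff_specializes P Q).mpr
      (hι'.isInducing.specializes_iff.mp hx)
    exact natTrdeg_quotient_lt_of_lt (lt_of_le_of_ne hPQ fun h ↦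
      hne (congrArg ι (PrimeSpectrum.ext h)))
  exists_eq_add_one {x x'} hx hne := by
    obtain ⟨-, B, -, _, -, _, -, -, ι, -, -, hB, -, hι', -, hι, -, Q, rfl⟩ :=
      exists_affine_chart (𝟙 X) s s (Category.id_comp s) x'
    obtain ⟨P, rfl⟩ := hx.mem_open hι'.isOpen_range ⟨Q, rfl⟩
    have hPQ : P ≤ Q := (PrimeSpectrum.le_iff_specializes P Q).mpr
      (hι'.isInducing.specializes_iff.mp hx)
    obtain ⟨W, hW, hPW, hWQ, hd⟩ := exists_isPrime_natTrdeg_eq_add_one (K := k)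
      (P := P.asIdeal) (Q := Q.asIdeal)
      (lt_of_le_of_ne hPQ fun h ↦ hne (congrArg ι (PrimeSpectrum.ext h)))
    let w : PrimeSpectrum B := ⟨W, hW⟩
    refine ⟨ι w, ?_, ?_, by rw [hι, hι]; exact hd⟩
    · exact ((PrimeSpectrum.le_iff_specializes P w).mp hPW).map hι'.continuous
    · exact ((PrimeSpectrum.le_iff_specializes w Q).mp hWQ.le).map hι'.continuous
  exists_eq_zero x := by
    obtain ⟨-, B, -, _, -, _, -, -, ι, -, -, hB, -, hι', -, hι, -, P, rfl⟩ :=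
      exists_affine_chart (𝟙 X) s s (Category.id_comp s) x
    have : P.asIdeal.LiesOver (⊥ : Ideal k) :=
      ⟨((P.asIdeal.under k).eq_bot_of_prime).symm⟩
    obtain ⟨Q, hQ, -, hPQ, hd⟩ := exists_liesOver_natTrdeg_eq (K := k) (⊥ : Ideal k) P.asIdeal
    let w : PrimeSpectrum B := ⟨Q, hQ⟩
    refine ⟨ι w, ((PrimeSpectrum.le_iff_specializes P w).mp hPQ).map hι'.continuous, ?_⟩
    rw [hι]
    refine hd.trans ?_
    simp [natTrdeg, trdeg_eq_zero (R := k) (A := k ⧸ (⊥ : Ideal k))]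

section morphism

variable {X Y : Scheme.{u}} (f : X ⟶ Y) (sX : X ⟶ Spec (.of k)) (sY : Y ⟶ Spec (.of k))
  [LocallyOfFiniteType sX] [LocallyOfFiniteType sY]

lemma pointTrdeg_map_le (h : f ≫ sY = sX) (x : X) : pointTrdeg sY (f x) ≤ pointTrdeg sX x := by
  obtain ⟨A, B, _, _, _, _, _, ιY, ιX, _, _, _, hιY, hιX, hY, hX, hf, P, rfl⟩ :=
    exists_affine_chart f sX sY h x
  rw [hf, hY, hX]
  have : P.asIdeal.LiesOver (PrimeSpectrum.comap (algebraMap A B) P).asIdeal := ⟨rfl⟩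
  exact natTrdeg_quotient_le_of_liesOver _ _

lemma exists_specializes_pointTrdeg_eq (h : f ≫ sY = sX) (x : X) :
    ∃ x', x ⤳ x' ∧ f x' = f x ∧ pointTrdeg sX x' = pointTrdeg sY (f x) := by
  obtain ⟨A, B, _, _, _, _, _, ιY, ιX, _, _, _, hιY, hιX, hY, hX, hf, P, rfl⟩ :=
    exists_affine_chart f sX sY h x
  have : P.asIdeal.LiesOver (PrimeSpectrum.comap (algebraMap A B) P).asIdeal := ⟨rfl⟩
  obtain ⟨Q, hQ, hQP, hPQ, hd⟩ := exists_liesOver_natTrdeg_eq (K := k)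
    (PrimeSpectrum.comap (algebraMap A B) P).asIdeal P.asIdeal
  let w : PrimeSpectrum B := ⟨Q, hQ⟩
  refine ⟨ιX w, ((PrimeSpectrum.le_iff_specializes P w).mp hPQ).map hιX.continuous, ?_, ?_⟩
  · rw [hf, hf]
    exact congrArg ιY (PrimeSpectrum.ext hQP.over.symm)
  · rw [hf, hX, hY]
    exact hd

lemma exists_specializes_pointTrdeg_add_le (h : f ≫ sY = sX) {x z : X} (hx : x ⤳ z) :
    ∃ η ζ, η ⤳ z ∧ f η = f z ∧ ζ ⤳ f z ∧
      pointTrdeg sX x + pointTrdeg sY (f z) ≤ pointTrdeg sX η + pointTrdeg sY ζ := by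
  obtain ⟨A, B, _, _, _, _, _, ιY, ιX, _, _, _, hιY, hιX, hY, hX, hf, Q, rfl⟩ :=
    exists_affine_chart f sX sY h z
  obtain ⟨P, rfl⟩ := hx.mem_open hιX.isOpen_range ⟨Q, rfl⟩
  have hPQ : P ≤ Q := (PrimeSpectrum.le_iff_specializes P Q).mpr
    (hιX.isInducing.specializes_iff.mp hx)
  have : Q.asIdeal.LiesOver (PrimeSpectrum.comap (algebraMap A B) Q).asIdeal := ⟨rfl⟩
  obtain ⟨η, ζ, hη, hζ, hηq, hηQ, hζq, hd⟩ := exists_natTrdeg_add_le (K := k)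
    (PrimeSpectrum.comap (algebraMap A B) Q).asIdeal (P := P.asIdeal) (Q := Q.asIdeal) hPQ
  let η' : PrimeSpectrum B := ⟨η, hη⟩
  let ζ' : PrimeSpectrum A := ⟨ζ, hζ⟩
  refine ⟨ιX η', ιY ζ', ((PrimeSpectrum.le_iff_specializes η' Q).mp hηQ).map hιX.continuous,
    ?_, ?_, ?_⟩
  · rw [hf, hf]
    exact congrArg ιY (PrimeSpectrum.ext hηq.over.symm)
  · rw [hf]
    exact ((PrimeSpectrum.le_iff_specializes ζ' _).mp hζq).map hιY.continuous
  · rw [hf, hX, hY, hX, hY]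
    exact hd

end morphism

end charts

end AlgebraicGeometry

/-- For an *open* morphism `f : X ⟶ Y` of schemes of finite type over an algebraically
closed field `k`, for every `z ∈ X` one has `dim_z X − dim_{f z} Y = dim_z f⁻¹(f z)`,
written additively. -/
theorem statement1 {k : Type} [Field k] [IsAlgClosed k]
    (X Y : Scheme) (f : X ⟶ Y)
    (sX : X ⟶ Spec (CommRingCat.of k)) (sY : Y ⟶ Spec (CommRingCat.of k))
    [LocallyOfFiniteType sX] [LocallyOfFiniteType sY]
    [CompactSpace X] [CompactSpace Y]
    (hcomm : f ≫ sY = sX)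
    (hopen : IsOpenMap f.base) (z : X) :
    localDim X z =
      localDim (f.base ⁻¹' {f.base z} : Set X) ⟨z, rfl⟩ + localDim Y (f.base z) := by
  have : IsLocallyNoetherian X := LocallyOfFiniteType.isLocallyNoetherian sX
  have : IsNoetherian X := { }
  have hq (y : Y) : QuasiSober (f.base ⁻¹' {y} : Set X) :=
    (f.fiberHomeo y).symm.isClosedEmbedding.quasiSober
  exact (isDimensionFunction_pointTrdeg sX).localDim_add (isDimensionFunction_pointTrdeg sY)
    hopen f.continuous z hq (pointTrdeg_map_le f sX sY hcomm)
    (exists_specializes_pointTrdeg_eq f sX sY hcomm)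
    fun _ ↦ exists_specializes_pointTrdeg_add_le f sX sY hcomm
end

section
/- Let f : X → Y be a morphism of schemes of finite type over an algebraically closed field k. Then there exists an open dense subset U ⊆ Y such that the function y ↦ dim f⁻¹(y) is locally constant on U, and for every z ∈ f⁻¹(U) one has dim_z(X) − dim_{f(z)}(Y) = dim_z(f⁻¹(f(z))). (Here dim ∅ = −∞.) -/
open AlgebraicGeometry CategoryTheory Topology

/-- Integral injective extensions preserve Krull dimension. -/
theorem ringKrullDim_eq_of_isIntegral_of_injective {R S : Type*} [CommRing R] [CommRing S]
    [Algebra R S] [Algebra.IsIntegral R S]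
    (h : Function.Injective (algebraMap R S)) : ringKrullDim S = ringKrullDim R := by
  apply le_antisymm
  · refine Order.krullDim_le_of_strictMono (PrimeSpectrum.comap (algebraMap R S)) fun p q hpq ↦ ?_
    exact Ideal.IsIntegral.comap_lt_comap hpq
  · refine iSup_le fun l ↦ ?_
    obtain ⟨⟨P, hP⟩, hPl⟩ := algebraMap_isIntegral_iff.mpr ‹_› |>.comap_surjective h l.head
    have : P.LiesOver l.head.asIdeal := ⟨congr($(hPl.symm).asIdeal)⟩
    obtain ⟨L, hL, -⟩ := Ideal.exists_ltSeries_of_hasGoingUp l P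
    rw [← hL]
    exact Order.LTSeries.length_le_krullDim L

theorem exists_ringKrullDim_eq_trdeg (k B : Type*) [Field k] [CommRing B] [IsDomain B]
    [Algebra k B] [Algebra.FiniteType k B] :
    ∃ s : ℕ, ringKrullDim B = s ∧ Algebra.trdeg k B = s := by
  obtain ⟨s, g, hg, hi⟩ := exists_integral_inj_algHom_of_fg k B
  algebraize [g.toRingHom]
  have : IsScalarTower k (MvPolynomial (Fin s) k) B := .of_algebraMap_eq fun x ↦ (g.commutes x).symm
  refine ⟨s, ?_, ?_⟩
  · rw [ringKrullDim_eq_of_isIntegral_of_injective (R := MvPolynomial (Fin s) k) hg]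
    simp
  · have : FaithfulSMul (MvPolynomial (Fin s) k) B :=
      (faithfulSMul_iff_algebraMap_injective _ _).mpr hg
    have := lift_trdeg_add_eq k (MvPolynomial (Fin s) k) B
    rw [trdeg_eq_zero (R := MvPolynomial (Fin s) k), MvPolynomial.trdeg_of_isDomain] at this
    simpa using this.symm

theorem ringKrullDim_eq_of_isLocalization_away {k B : Type*} [Field k] [CommRing B] [IsDomain B]
    [Algebra k B] [Algebra.FiniteType k B] (b : B) (hb : b ≠ 0) (C : Type*) [CommRing C]
    [Algebra B C] [IsLocalization.Away b C] : ringKrullDim C = ringKrullDim B := by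
  algebraize [(algebraMap B C).comp (algebraMap k B)]
  have hM : Submonoid.powers b ≤ nonZeroDivisors B := powers_le_nonZeroDivisors_of_noZeroDivisors hb
  have : IsDomain C := IsLocalization.isDomain_of_le_nonZeroDivisors _ hM
  have : Algebra.FiniteType B C := IsLocalization.finiteType_of_monoid_fg (Submonoid.powers b) C
  have : Algebra.FiniteType k C := .trans ‹_› ‹_›
  have : FaithfulSMul B C :=
      (faithfulSMul_iff_algebraMap_injective _ _).mpr (IsLocalization.injective _ hM)
  have : Algebra.IsAlgebraic B C := IsLocalization.isAlgebraic C (Submonoid.powers b)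
  obtain ⟨s, h1, h2⟩ := exists_ringKrullDim_eq_trdeg k B
  obtain ⟨t, h3, h4⟩ := exists_ringKrullDim_eq_trdeg k C
  have := lift_trdeg_add_eq k B C
  rw [trdeg_eq_zero (R := B)] at this
  simp only [h2, h4, Cardinal.lift_zero, add_zero, Cardinal.lift_natCast, Nat.cast_inj] at this
  rw [h1, h3, this]

section Topology

variable {X Y : Type*} [TopologicalSpace X] [TopologicalSpace Y]

theorem topologicalKrullDim_mono {S T : Set X} (h : S ⊆ T) :
    topologicalKrullDim S ≤ topologicalKrullDim T :=
  (IsEmbedding.inclusion h).isInducing.topologicalKrullDim_le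

theorem Topology.IsEmbedding.topologicalKrullDim_image {e : X → Y} (he : IsEmbedding e)
    (S : Set X) : topologicalKrullDim (e '' S) = topologicalKrullDim S :=
  ((he.homeomorphImage S).isHomeomorph.topologicalKrullDim_eq _).symm

theorem Topology.IsEmbedding.topologicalKrullDim_range {e : X → Y} (he : IsEmbedding e) :
    topologicalKrullDim (Set.range e) = topologicalKrullDim X :=
  (he.toHomeomorph.isHomeomorph.topologicalKrullDim_eq _).symm

theorem topologicalKrullDim_le_of_forall_exists_isOpen {d : WithBot ℕ∞}
    (h : ∀ x : X, ∃ U : Set X, IsOpen U ∧ x ∈ U ∧ topologicalKrullDim U ≤ d) :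
    topologicalKrullDim X ≤ d := by
  refine iSup_le fun l ↦ ?_
  obtain ⟨x, hx⟩ := l.head.isIrreducible.nonempty
  obtain ⟨U, hU, hxU, hd⟩ := h x
  refine le_trans ?_ hd
  let P : Set (TopologicalSpace.IrreducibleCloseds X) :=
    {V | (((↑) : U → X) ⁻¹' (V : Set X)).Nonempty}
  have hl (i) : l i ∈ P := ⟨⟨x, hxU⟩, l.head_le i hx⟩
  let l' : LTSeries P := ⟨l.length, fun i ↦ ⟨l i, hl i⟩, fun i ↦ l.step i⟩
  unfold topologicalKrullDim
  rw [Order.krullDim_eq_of_orderIso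
    (TopologicalSpace.IrreducibleCloseds.orderIsoOfIsOpenEmbedding _ hU.isOpenEmbedding_subtypeVal)]
  exact Order.LTSeries.length_le_krullDim l'

theorem topologicalKrullDim_coe_le_of_forall_exists_isOpen {S : Set X} {d : WithBot ℕ∞}
    (h : ∀ x ∈ S, ∃ U : Set X, IsOpen U ∧ x ∈ U ∧ topologicalKrullDim (S ∩ U : Set X) ≤ d) :
    topologicalKrullDim S ≤ d := by
  refine topologicalKrullDim_le_of_forall_exists_isOpen fun ⟨x, hx⟩ ↦ ?_
  obtain ⟨U, hU, hxU, hd⟩ := h x hx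
  refine ⟨((↑) : S → X) ⁻¹' U, hU.preimage continuous_subtype_val, hxU, ?_⟩
  rwa [← IsEmbedding.subtypeVal.topologicalKrullDim_image, Subtype.image_preimage_coe]

/-- Every maximal irreducible subset of `S` has Krull dimension `d`. -/
def IsPureDimOn (S : Set X) (d : WithBot ℕ∞) : Prop :=
  ∀ C, Maximal (fun C ↦ IsIrreducible C ∧ C ⊆ S) C → topologicalKrullDim C = d

theorem Topology.IsInducing.isIrreducible_image_iff {e : X → Y} (he : IsInducing e) {C : Set X} :
    IsIrreducible (e '' C) ↔ IsIrreducible C := by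
  refine ⟨fun h ↦ ⟨h.1.of_image, fun U V hU hV hCU hCV ↦ ?_⟩,
    fun h ↦ h.image e he.continuous.continuousOn⟩
  obtain ⟨U, hU', rfl⟩ := he.isOpen_iff.mp hU
  obtain ⟨V, hV', rfl⟩ := he.isOpen_iff.mp hV
  rw [← Set.preimage_inter, ← Set.image_inter_nonempty_iff]
  rw [← Set.image_inter_nonempty_iff] at hCU hCV
  exact h.2 U V hU' hV' hCU hCV

theorem Topology.IsEmbedding.isPureDimOn_image {e : X → Y} (he : IsEmbedding e) {S : Set X}
    {d : WithBot ℕ∞} (h : IsPureDimOn S d) : IsPureDimOn (e '' S) d := by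
  rintro C ⟨⟨hC, hCS⟩, hmax⟩
  obtain ⟨C, hCS', rfl⟩ := Set.subset_image_iff.mp hCS
  rw [he.topologicalKrullDim_image]
  refine h C ⟨⟨he.isInducing.isIrreducible_image_iff.mp hC, hCS'⟩, fun D hD hle ↦ ?_⟩
  exact (Set.image_subset_image_iff he.injective).mp <| hmax (y := e '' D)
    ⟨he.isInducing.isIrreducible_image_iff.mpr hD.1, Set.image_mono hD.2⟩ (Set.image_mono hle)

theorem isPureDimOn_range_of_forall_irreducibleComponents {e : X → Y} (he : IsEmbedding e)
    {d : WithBot ℕ∞} (h : ∀ C ∈ irreducibleComponents X, topologicalKrullDim C = d) :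
    IsPureDimOn (Set.range e) d := by
  rw [← Set.image_univ]
  refine he.isPureDimOn_image fun C hC ↦ h C ?_
  simpa [irreducibleComponents] using! hC

theorem IsIrreducible.subset_of_inter_subset {C U Z : Set X} (hC : IsIrreducible C) (hU : IsOpen U)
    (hZ : IsClosed Z) (hCU : (C ∩ U).Nonempty) (h : C ∩ U ⊆ Z) : C ⊆ Z :=
  (subset_closure_inter_of_isPreirreducible_of_isOpen hC.2 hU hCU).trans
    (closure_minimal h hZ)

theorem IsIrreducible.inter_isOpen {C U : Set X} (hC : IsIrreducible C) (hU : IsOpen U)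
    (hCU : (C ∩ U).Nonempty) : IsIrreducible (C ∩ U) := by
  refine ⟨hCU, isPreirreducible_iff_closure.mp ?_⟩
  rw [subset_antisymm (closure_mono Set.inter_subset_left) (closure_minimal
    (subset_closure_inter_of_isPreirreducible_of_isOpen hC.2 hU hCU) isClosed_closure)]
  exact isPreirreducible_iff_closure.mpr hC.2

theorem IsPureDimOn.of_isOpen_cover {S : Set X} {d : WithBot ℕ∞}
    (h : ∀ x ∈ S, ∃ U : Set X, IsOpen U ∧ x ∈ U ∧ IsPureDimOn (S ∩ U) d) : IsPureDimOn S d := by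
  rintro C ⟨⟨hC, hCS⟩, hmax⟩
  have key : ∀ x ∈ C, ∃ U : Set X, IsOpen U ∧ x ∈ U ∧ topologicalKrullDim (C ∩ U : Set X) = d := by
    intro x hx
    obtain ⟨U, hU, hxU, hd⟩ := h x (hCS hx)
    refine ⟨U, hU, hxU, hd _ ⟨⟨hC.inter_isOpen hU ⟨x, hx, hxU⟩, by gcongr⟩, ?_⟩⟩
    intro D ⟨hD, hDS⟩ hle
    have h1 : C ⊆ closure D :=
      hC.subset_of_inter_subset hU isClosed_closure ⟨x, hx, hxU⟩ (hle.trans subset_closure)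
    have h2 : IsIrreducible (closure D ∩ S) := by
      refine ⟨hC.1.mono (Set.subset_inter h1 hCS), ?_⟩
      refine isPreirreducible_iff_closure.mp ?_
      rw [subset_antisymm (closure_minimal Set.inter_subset_left isClosed_closure) (closure_mono
        (Set.subset_inter subset_closure (hDS.trans Set.inter_subset_left)))]
      exact isPreirreducible_iff_closure.mpr hD.2
    have h3 := hmax (y := closure D ∩ S) ⟨h2, Set.inter_subset_right⟩ (Set.subset_inter h1 hCS)
    exact fun y hy ↦ ⟨h3 ⟨subset_closure hy, (hDS hy).1⟩, (hDS hy).2⟩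
  apply le_antisymm
  · refine topologicalKrullDim_coe_le_of_forall_exists_isOpen fun x hx ↦ ?_
    obtain ⟨U, hU, hxU, hd⟩ := key x hx
    exact ⟨U, hU, hxU, hd.le⟩
  · obtain ⟨x, hx⟩ := hC.1
    obtain ⟨U, hU, hxU, hd⟩ := key x hx
    exact hd.ge.trans (topologicalKrullDim_mono Set.inter_subset_left)

theorem IsPureDimOn.inter_of_isClosed_of_isOpen {S U Z : Set X} {d : WithBot ℕ∞}
    (h : IsPureDimOn S d) (hU : IsOpen U) (hZ : IsClosed Z) (hUZ : S ∩ U = S ∩ Z) :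
    IsPureDimOn (S ∩ U) d := by
  rintro C ⟨⟨hC, hCS⟩, hmax⟩
  refine h C ⟨⟨hC, hCS.trans Set.inter_subset_left⟩, fun D ⟨hD, hDS⟩ hle ↦ ?_⟩
  refine hmax ⟨hD, ?_⟩ hle
  rw [hUZ]
  refine Set.subset_inter hDS (hD.subset_of_inter_subset hU hZ ?_ ?_)
  · exact hC.1.mono fun x hx ↦ ⟨hle hx, (hCS hx).2⟩
  · exact fun x hx ↦ (hUZ.le ⟨hDS hx.1, hx.2⟩).2

theorem mem_irreducibleComponents_coe_iff {S : Set X} {C : Set S} :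
    C ∈ irreducibleComponents S ↔
      Maximal (fun C ↦ IsIrreducible C ∧ C ⊆ S) (((↑) : S → X) '' C) := by
  have hi := IsInducing.subtypeVal (t := S)
  constructor
  · refine fun h ↦ ⟨⟨hi.isIrreducible_image_iff.mpr h.1, by simp⟩, ?_⟩
    rintro D ⟨hD, hDS⟩ hle
    obtain ⟨D, rfl⟩ : ∃ E : Set S, (↑) '' E = D := ⟨(↑) ⁻¹' D, by simpa using hDS⟩
    exact Set.image_mono (h.2 (hi.isIrreducible_image_iff.mp hD)
      ((Set.image_subset_image_iff Subtype.val_injective).mp hle))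
  · refine fun h ↦ ⟨hi.isIrreducible_image_iff.mp h.1.1, fun D hD hle ↦ ?_⟩
    exact (Set.image_subset_image_iff Subtype.val_injective).mp <| h.2 (y := (↑) '' D)
      ⟨hi.isIrreducible_image_iff.mpr hD, by simp⟩ (Set.image_mono hle)

theorem exists_maximal_isIrreducible_superset {S C : Set X} (hC : IsIrreducible C) (hCS : C ⊆ S) :
    ∃ D, C ⊆ D ∧ Maximal (fun C ↦ IsIrreducible C ∧ C ⊆ S) D := by
  obtain ⟨C, rfl⟩ : ∃ E : Set S, (↑) '' E = C := ⟨(↑) ⁻¹' C, by simpa using hCS⟩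
  obtain ⟨D, hD, hle⟩ := exists_mem_irreducibleComponents_subset_of_isIrreducible C
    (IsInducing.subtypeVal.isIrreducible_image_iff.mp hC)
  exact ⟨_, Set.image_mono hle, mem_irreducibleComponents_coe_iff.mp hD⟩

theorem IsIrreducible.exists_subset_of_subset_iUnion {ι : Type*} [Finite ι] {C : Set X}
    (hC : IsIrreducible C) {Z : ι → Set X} (hZ : ∀ j, IsClosed (Z j)) (h : C ⊆ ⋃ j, Z j) :
    ∃ j, C ⊆ Z j := by
  have := Fintype.ofFinite ι
  classical
  obtain ⟨z, hz, hCz⟩ := isIrreducible_iff_sUnion_isClosed.mp hC (Finset.univ.image Z)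
    (by simpa using hZ) (by simpa using h)
  obtain ⟨j, -, rfl⟩ := Finset.mem_image.mp hz
  exact ⟨j, hCz⟩

theorem topologicalKrullDim_eq_iSup_of_isClosed_cover {ι : Type*} [Finite ι] {S : Set X}
    {Z : ι → Set X} (hZ : ∀ j, IsClosed (Z j)) (h : S ⊆ ⋃ j, Z j) :
    topologicalKrullDim S = ⨆ j, topologicalKrullDim (S ∩ Z j : Set X) := by
  refine le_antisymm (iSup_le fun l ↦ ?_)
    (iSup_le fun j ↦ topologicalKrullDim_mono Set.inter_subset_left)
  obtain ⟨j, hj⟩ := l.last.isIrreducible.exists_subset_of_subset_iUnion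
    (fun j ↦ (hZ j).preimage (continuous_subtype_val (p := (· ∈ S))))
    (by simpa only [← Set.preimage_iUnion, ← Set.image_subset_iff] using
      (Subtype.coe_image_subset S _).trans h)
  refine le_trans ?_ (le_iSup _ j)
  let e := IsEmbedding.inclusion (Set.inter_subset_left : S ∩ Z j ⊆ S)
  have hr (i) : (l i : Set S) ⊆ Set.range (Set.inclusion (Set.inter_subset_left : S ∩ Z j ⊆ S)) :=
    fun x hx ↦ ⟨⟨x, x.2, hj (l.monotone (Fin.le_last i) hx)⟩, rfl⟩
  let l' : LTSeries (TopologicalSpace.IrreducibleCloseds (S ∩ Z j : Set X)) :=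
    ⟨l.length, fun i ↦ ⟨Set.inclusion Set.inter_subset_left ⁻¹' (l i),
      e.isInducing.isIrreducible_image_iff.mp
        ((Set.image_preimage_eq_of_subset (hr i)).symm ▸ (l i).isIrreducible),
      (l i).isClosed.preimage e.continuous⟩, fun i ↦ by
      have : l i.castSucc < l i.succ := l.step i
      refine lt_of_le_of_ne (Set.preimage_mono this.le) fun heq ↦ this.ne ?_
      apply TopologicalSpace.IrreducibleCloseds.ext
      have := congr(Set.inclusion Set.inter_subset_left '' ($heq : Set _))
      simpa [Set.image_preimage_eq_of_subset (hr _)] using! this⟩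
  exact Order.LTSeries.length_le_krullDim l'

theorem localDim_eq_iSup_of_isClosed_cover {ι : Type*} [Finite ι] {S : Set X} (z : S)
    {Z : ι → Set X} (hZ : ∀ j, IsClosed (Z j)) (h : S ⊆ ⋃ j, Z j) {d : ι → WithBot ℕ∞}
    (hd : ∀ j, IsPureDimOn (S ∩ Z j) (d j)) :
    localDim S z = ⨆ j, ⨆ (_ : (z : X) ∈ Z j), d j := by
  refine le_antisymm (iSup₂_le fun C ⟨hC, hzC⟩ ↦ ?_) (iSup₂_le fun j hj ↦ ?_)
  · rw [mem_irreducibleComponents_coe_iff] at hC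
    obtain ⟨j, hj⟩ := hC.1.1.exists_subset_of_subset_iUnion hZ (hC.1.2.trans h)
    have := hd j _ ⟨⟨hC.1.1, Set.subset_inter hC.1.2 hj⟩, fun D hD hle ↦
      hC.2 ⟨hD.1, hD.2.trans Set.inter_subset_left⟩ hle⟩
    rw [← IsEmbedding.subtypeVal.topologicalKrullDim_image, this]
    exact le_iSup₂_of_le j (hj ⟨z, hzC, rfl⟩) le_rfl
  · obtain ⟨D, hzD, hD⟩ := exists_maximal_isIrreducible_superset (S := S ∩ Z j)
      (isIrreducible_singleton (x := (z : X))) (by simp [hj])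
    obtain ⟨E, hDE, hE⟩ := exists_maximal_isIrreducible_superset hD.1.1
      (hD.1.2.trans Set.inter_subset_left)
    obtain ⟨E, rfl⟩ : ∃ F : Set S, (↑) '' F = E := ⟨(↑) ⁻¹' E, by simpa using hE.1.2⟩
    refine le_iSup₂_of_le E ⟨mem_irreducibleComponents_coe_iff.mpr hE, ?_⟩ ?_
    · simpa using hDE (hzD rfl)
    · rw [← hd j D hD, ← IsEmbedding.subtypeVal.topologicalKrullDim_image E]
      exact topologicalKrullDim_mono hDE

end Topology

section GenericNoether

attribute [local instance] MvPolynomial.algebraMvPolynomial in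
/-- Generic Noether normalization: a finitely generated extension of domains `A ⊆ B` is, after
inverting a nonzero element of `A`, integral over a polynomial subring. -/
theorem exists_mvPolynomial_algHom_injective_forall_isIntegralElem {A B : Type*} [CommRing A]
    [IsDomain A] [CommRing B] [IsDomain B] [Algebra A B] [hft : Algebra.FiniteType A B]
    (h : Function.Injective (algebraMap A B)) :
    ∃ (n : ℕ) (g : MvPolynomial (Fin n) A →ₐ[A] B) (a : A), a ≠ 0 ∧ Function.Injective g ∧
      ∀ b, ∃ N : ℕ, g.toRingHom.IsIntegralElem (a ^ N • b) := by
  classical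
  let K := FractionRing A
  let M := Algebra.algebraMapSubmonoid B (nonZeroDivisors A)
  have hM : M ≤ nonZeroDivisors B := by
    refine map_le_nonZeroDivisors_of_injective _ h le_rfl
  let L := Localization M
  have : IsDomain L := IsLocalization.isDomain_of_le_nonZeroDivisors _ hM
  have hBL : Function.Injective (algebraMap B L) := IsLocalization.injective _ hM
  have : Algebra.FiniteType K L :=
    .equiv inferInstance (Localization.tensorRightAlgEquiv (nonZeroDivisors A) B)
  obtain ⟨n, g, hg, hi⟩ := exists_integral_inj_algHom_of_fg K L
  obtain ⟨⟨_, s, hs, rfl⟩, hb⟩ := IsLocalization.exist_integer_multiples_of_finite M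
    fun i : Fin n ↦ g (.X i)
  choose y hy using hb
  have hsK : algebraMap A K s ≠ 0 := by simpa using nonZeroDivisors.ne_zero hs
  let σ : MvPolynomial (Fin n) K →ₐ[K] MvPolynomial (Fin n) K :=
    MvPolynomial.aeval fun i ↦ .C (algebraMap A K s) * .X i
  let τ : MvPolynomial (Fin n) K →ₐ[K] MvPolynomial (Fin n) K :=
    MvPolynomial.aeval fun i ↦ .C (algebraMap A K s)⁻¹ * .X i
  have hστ : σ.comp τ = .id _ _ := by
    ext i : 1
    simp [σ, τ, MvPolynomial.algHom_C, ← mul_assoc, ← MvPolynomial.C_mul, hsK]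
  have hτσ : τ.comp σ = .id _ _ := by
    ext i : 1
    simp [σ, τ, MvPolynomial.algHom_C, ← mul_assoc, ← MvPolynomial.C_mul, hsK]
  let u : MvPolynomial (Fin n) K →ₐ[K] L := g.comp σ
  have hu : Function.Injective u := hg.comp
    (Function.LeftInverse.injective (g := τ) fun x ↦ congr($hτσ x))
  have hui : u.toRingHom.IsIntegral :=
    RingHom.IsIntegral.trans σ.toRingHom g.toRingHom
      (RingHom.isIntegral_of_surjective _
        (Function.RightInverse.surjective (g := τ) fun x ↦ congr($hστ x))) hi
  let v : MvPolynomial (Fin n) A →ₐ[A] B := MvPolynomial.aeval y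
  have huv (p) : algebraMap B L (v p) = u (MvPolynomial.map (algebraMap A K) p) := by
    have : (IsScalarTower.toAlgHom A B L).comp v =
        (u.restrictScalars A).comp (MvPolynomial.mapAlgHom (Algebra.ofId A K)) := by
      ext i : 1
      simp [v, u, σ, hy, MvPolynomial.algHom_C, Algebra.smul_def]
      exact .inl (by rw [← IsScalarTower.algebraMap_apply A B L, IsScalarTower.algebraMap_apply A K L])
    exact congr($this p)
  have hv : Function.Injective v := by
    refine Function.Injective.of_comp (f := algebraMap B L) ?_
    rw [show algebraMap B L ∘ v = u ∘ MvPolynomial.map (algebraMap A K) from funext huv]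
    exact hu.comp (MvPolynomial.map_injective _ (IsFractionRing.injective A K))
  have key (b : B) : ∃ s : A, s ≠ 0 ∧ v.toRingHom.IsIntegralElem (s • b) := by
    algebraize [v.toRingHom, u.toRingHom, (algebraMap B L).comp v.toRingHom]
    have : IsScalarTower (MvPolynomial (Fin n) A) (MvPolynomial (Fin n) K) L :=
      .of_algebraMap_eq huv
    obtain ⟨⟨_, s, hs, rfl⟩, hm⟩ := IsIntegral.exists_multiple_integral_of_isLocalization
      (R := MvPolynomial (Fin n) A) (Rₘ := MvPolynomial (Fin n) K)
      ((nonZeroDivisors A).map (MvPolynomial.C (σ := Fin n)))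
      (algebraMap B L b) (hui _)
    refine ⟨s, nonZeroDivisors.ne_zero hs, ?_⟩
    have : IsScalarTower (MvPolynomial (Fin n) A) B L := .of_algebraMap_eq' rfl
    refine (isIntegral_algebraMap_iff hBL).mp ?_
    have e : algebraMap B L (s • b) =
        (MvPolynomial.C s : MvPolynomial (Fin n) A) • algebraMap B L b := by
      rw [Algebra.smul_def, Algebra.smul_def, map_mul, IsScalarTower.algebraMap_apply _ B L]
      exact congrArg (algebraMap B L · * algebraMap B L b) (v.commutes s).symm
    rw [e]
    exact hm
  obtain ⟨t, ht⟩ := hft.out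
  choose w hw hwi using key
  refine ⟨n, v, ∏ c ∈ t, w c, Finset.prod_ne_zero_iff.mpr fun c _ ↦ hw c, hv, fun b ↦ ?_⟩
  have hb : b ∈ Algebra.adjoin A (t : Set B) := ht ▸ trivial
  have hC (a : A) : v.toRingHom.IsIntegralElem (algebraMap A B a) := by
    rw [← v.commutes]; exact RingHom.isIntegralElem_map _
  induction hb using Algebra.adjoin_induction with
  | mem x hx =>
    refine ⟨1, ?_⟩
    rw [pow_one, ← Finset.prod_erase_mul _ _ hx, mul_smul, Algebra.smul_def]
    exact (hC _).mul _ (hwi x)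
  | algebraMap r => exact ⟨0, by simpa using hC r⟩
  | add x y hx hy h₁ h₂ =>
    obtain ⟨N₁, h₁⟩ := h₁
    obtain ⟨N₂, h₂⟩ := h₂
    refine ⟨N₁ + N₂, ?_⟩
    have := ((hC ((∏ c ∈ t, w c) ^ N₂)).mul _ h₁).add _ ((hC ((∏ c ∈ t, w c) ^ N₁)).mul _ h₂)
    convert this using 1
    simp only [Algebra.smul_def, map_pow]
    ring
  | mul x y hx hy h₁ h₂ =>
    obtain ⟨N₁, h₁⟩ := h₁
    obtain ⟨N₂, h₂⟩ := h₂
    refine ⟨N₁ + N₂, ?_⟩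
    convert h₁.mul _ h₂ using 1
    rw [smul_mul_smul_comm, pow_add]

end GenericNoether

section GenericFibre

variable {R S : Type*} [CommRing R] [CommRing S] [Algebra R S]

theorem isIntegral_localization_of_forall_isIntegral_pow_smul (r : R)
    (h : ∀ b : S, ∃ N : ℕ, IsIntegral R (r ^ N • b)) :
    Algebra.IsIntegral (Localization (.powers r))
      (Localization (Algebra.algebraMapSubmonoid S (.powers r))) := by
  refine ⟨fun x ↦ ?_⟩
  obtain ⟨b, ⟨_, _, ⟨m, rfl⟩, rfl⟩, rfl⟩ := IsLocalization.exists_mk'_eq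
    (Algebra.algebraMapSubmonoid S (.powers r)) x
  obtain ⟨N, hN⟩ := h b
  have hu : IsUnit (algebraMap R (Localization (.powers r)) (r ^ (N + m))) :=
    IsLocalization.map_units _ (⟨r ^ (N + m), _, rfl⟩ : Submonoid.powers r)
  obtain ⟨u, hu⟩ := hu
  have := (hN.algebraMap (B := (Localization (Algebra.algebraMapSubmonoid S (.powers r))))).tower_top
    (A := Localization (.powers r)) |>.smul (u⁻¹).1
  convert this
  rw [← Units.smul_def, eq_inv_smul_iff, Units.smul_def, hu, algebraMap_smul, pow_add, mul_smul,
    Algebra.smul_def, Algebra.smul_def, Algebra.smul_def,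
    IsScalarTower.algebraMap_apply R S (Localization (Algebra.algebraMapSubmonoid S (.powers r))),
    IsScalarTower.algebraMap_apply R S (Localization (Algebra.algebraMapSubmonoid S (.powers r))),
    map_mul]
  congr 1
  exact IsLocalization.mk'_spec' (Localization (Algebra.algebraMapSubmonoid S (.powers r))) b _

/-- Lying over for an extension which is integral after inverting `r`. -/
theorem PrimeSpectrum.exists_comap_eq_of_forall_isIntegral_pow_smul
    (hinj : Function.Injective (algebraMap R S)) {r : R}
    (h : ∀ b : S, ∃ N : ℕ, IsIntegral R (r ^ N • b)) (p : PrimeSpectrum R) (hp : r ∉ p.asIdeal) :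
    ∃ q : PrimeSpectrum S, comap (algebraMap R S) q = p := by
  have hi := isIntegral_localization_of_forall_isIntegral_pow_smul r h
  have hd : Disjoint (Submonoid.powers r : Set R) p.asIdeal :=
    (Ideal.disjoint_powers_iff_notMem _ p.2.isRadical).mpr hp
  obtain ⟨p', hp'⟩ : p ∈ Set.range (comap (algebraMap R (Localization (.powers r)))) := by
    rw [localization_comap_range _ (.powers r)]
    exact hd
  obtain ⟨q, rfl⟩ := algebraMap_isIntegral_iff.mpr hi |>.comap_surjective
    (localizationAlgebra_injective _ _ hinj) p'
  refine ⟨comap (algebraMap S _) q, ?_⟩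
  rw [← hp', ← comap_comp_apply, ← comap_comp_apply, ← IsScalarTower.algebraMap_eq,
    ← IsScalarTower.algebraMap_eq]

/-- Going down for an extension of a normal domain which is integral after inverting `r`. -/
theorem PrimeSpectrum.exists_le_comap_eq_of_forall_isIntegral_pow_smul [IsDomain S]
    [IsIntegrallyClosed R] (hinj : Function.Injective (algebraMap R S)) {r : R} (hr : r ≠ 0)
    (h : ∀ b : S, ∃ N : ℕ, IsIntegral R (r ^ N • b)) (p : PrimeSpectrum R) (q : PrimeSpectrum S)
    (hp : p ≤ comap (algebraMap R S) q) (hq : r ∉ (comap (algebraMap R S) q).asIdeal) :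
    ∃ q' ≤ q, comap (algebraMap R S) q' = p := by
  have := isIntegral_localization_of_forall_isIntegral_pow_smul r h
  have : IsDomain R := hinj.isDomain
  have hM : Submonoid.powers r ≤ nonZeroDivisors R := powers_le_nonZeroDivisors_of_noZeroDivisors hr
  have : FaithfulSMul (Localization (.powers r))
      (Localization (Algebra.algebraMapSubmonoid S (.powers r))) :=
    (faithfulSMul_iff_algebraMap_injective _ _).mpr
      (localizationAlgebra_injective _ _ hinj)
  have : IsIntegrallyClosed (Localization (.powers r)) := isIntegrallyClosed_of_isLocalization _ _ hM
  have : IsDomain (Localization (Algebra.algebraMapSubmonoid S (.powers r))) :=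
    IsLocalization.isDomain_of_le_nonZeroDivisors
      (M := Algebra.algebraMapSubmonoid S (.powers r)) _ (map_le_nonZeroDivisors_of_injective _ hinj hM)
  obtain ⟨p', hp'⟩ : p ∈ Set.range (comap (algebraMap R (Localization (.powers r)))) := by
    rw [localization_comap_range _ (.powers r)]
    exact (Ideal.disjoint_powers_iff_notMem _ p.2.isRadical).mpr fun hr ↦ hq (hp hr)
  obtain ⟨q', hq'⟩ : q ∈ Set.range (comap (algebraMap S
      (Localization (Algebra.algebraMapSubmonoid S (.powers r))))) := by
    rw [localization_comap_range _ (Algebra.algebraMapSubmonoid S (.powers r)), Set.mem_ofPred_eq,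
      Set.disjoint_left]
    rintro _ ⟨_, ⟨n, rfl⟩, rfl⟩ hn
    simp only [map_pow] at hn
    exact hq (q.2.mem_of_pow_mem _ hn)
  obtain ⟨Q, hQ, hQ', hQp⟩ := Ideal.exists_ideal_le_liesOver_of_le (p := p'.asIdeal)
    (q := q'.asIdeal.under _) q'.asIdeal (by
      rw [← IsLocalization.map_under (.powers r) (Localization (.powers r)) p'.asIdeal,
        Ideal.map_le_iff_le_comap]
      rw [← hp', ← hq', ← comap_comp_apply, ← IsScalarTower.algebraMap_eq,
        IsScalarTower.algebraMap_eq R (Localization (.powers r))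
          (Localization (Algebra.algebraMapSubmonoid S (.powers r))), comap_comp_apply] at hp
      exact hp)
  refine ⟨comap (algebraMap S _) ⟨Q, hQ'⟩, ?_, ?_⟩
  · rw [← hq']
    exact Ideal.comap_mono hQ
  · obtain rfl : comap (algebraMap _ _) ⟨Q, hQ'⟩ = p' := PrimeSpectrum.ext hQp.over.symm
    rw [← hp', ← comap_comp_apply, ← comap_comp_apply, ← IsScalarTower.algebraMap_eq,
      ← IsScalarTower.algebraMap_eq]

end GenericFibre

section FibrePurity

theorem RingHom.ringKrullDim_quotient_eq_of_isIntegral {R S : Type*} [CommRing R] [CommRing S]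
    {f : R →+* S} (hf : f.IsIntegral) (Q : Ideal S)
    (hQ : Function.Injective ((Ideal.Quotient.mk Q).comp f)) :
    ringKrullDim (S ⧸ Q) = ringKrullDim R := by
  have := hf.trans _ _
    (RingHom.isIntegral_of_surjective _ (Ideal.Quotient.mk_surjective (I := Q)))
  algebraize [(Ideal.Quotient.mk Q).comp f]
  exact ringKrullDim_eq_of_isIntegral_of_injective (R := R) hQ

theorem topologicalKrullDim_zeroLocus {R : Type*} [CommRing R] (I : Ideal R) :
    topologicalKrullDim (PrimeSpectrum.zeroLocus (I : Set R)) = ringKrullDim (R ⧸ I) := by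
  rw [← PrimeSpectrum.topologicalKrullDim_eq_ringKrullDim,
    ← (PrimeSpectrum.isClosedEmbedding_comap_of_surjective _ (Ideal.Quotient.mk I)
      Ideal.Quotient.mk_surjective).isEmbedding.topologicalKrullDim_range,
    range_comap_of_surjective _ _ Ideal.Quotient.mk_surjective, Ideal.mk_ker]

variable {A R B : Type*} [CommRing A] [CommRing R] [CommRing B] [Algebra A R] [Algebra A B]
  (g : R →ₐ[A] B) (p : Ideal A) [p.IsPrime]

/-- The map induced by `g` on the fibres over `p`. -/
noncomputable def Ideal.fiberMap : p.Fiber R →ₐ[p.ResidueField] p.Fiber B :=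
  Algebra.TensorProduct.map (.id _ _) g

theorem Ideal.fiberMap_one_tmul (x : R) : p.fiberMap g (1 ⊗ₜ x) = 1 ⊗ₜ g x := by simp [fiberMap]

theorem Ideal.isUnit_algebraMap_residueField {r : A} (hr : r ∉ p) :
    IsUnit (algebraMap A p.ResidueField r) := by
  simpa using hr

theorem Ideal.fiberMap_isIntegral {a : A} (ha : a ∉ p)
    (h : ∀ b, ∃ N : ℕ, g.toRingHom.IsIntegralElem (a ^ N • b)) :
    (p.fiberMap g).toRingHom.IsIntegral := by
  intro x
  obtain ⟨r, hr, s, hs⟩ := Fiber.exists_smul_eq_one_tmul p x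
  obtain ⟨N, f, hf, hfs⟩ := h s
  obtain ⟨c, hc⟩ := p.isUnit_algebraMap_residueField (r := a ^ N * r)
    (p.primeCompl.mul_mem (p.primeCompl.pow_mem ha N) hr)
  have key : (p.fiberMap g).toRingHom.IsIntegralElem ((a ^ N * r) • x) := by
    refine ⟨f.map (Algebra.TensorProduct.includeRight (R := A) (A := p.ResidueField)).toRingHom,
      hf.map _, ?_⟩
    have e : (a ^ N * r) • x =
        Algebra.TensorProduct.includeRight (R := A) (A := p.ResidueField) (a ^ N • s) := by
      rw [mul_smul, hs, map_smul]; rfl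
    have e' : (p.fiberMap g).toRingHom.comp
        (Algebra.TensorProduct.includeRight (R := A) (A := p.ResidueField)).toRingHom =
        (Algebra.TensorProduct.includeRight (R := A) (A := p.ResidueField)).toRingHom.comp
          g.toRingHom := by
      ext x; exact p.fiberMap_one_tmul g x
    rw [Polynomial.eval₂_map, e', e]
    exact (Polynomial.hom_eval₂ _ _ _ _).symm.trans (by rw [hfs, map_zero])
  have h2 : (p.fiberMap g).toRingHom.IsIntegralElem
      (algebraMap p.ResidueField (p.Fiber B) (c⁻¹).1) := by
    rw [← (p.fiberMap g).commutes]; exact RingHom.isIntegralElem_map _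
  have e : x = algebraMap p.ResidueField (p.Fiber B) (c⁻¹).1 * ((a ^ N * r) • x) := by
    rw [← algebraMap_smul p.ResidueField (a ^ N * r) x, ← hc, ← Algebra.smul_def]
    simp
  exact (congrArg (p.fiberMap g).toRingHom.IsIntegralElem e).mpr (h2.mul _ key)

theorem Ideal.injective_mk_comp_fiberMap (Q : Ideal (p.Fiber B))
    (h : ∀ x : R, (1 ⊗ₜ g x : p.Fiber B) ∈ Q → (1 ⊗ₜ x : p.Fiber R) = 0) :
    Function.Injective ((Ideal.Quotient.mkₐ p.ResidueField Q).comp (p.fiberMap g)) := by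
  rw [injective_iff_map_eq_zero]
  intro x hx
  obtain ⟨r, hr, s, hs⟩ := Fiber.exists_smul_eq_one_tmul p x
  replace hx : p.fiberMap g x ∈ Q := Ideal.Quotient.eq_zero_iff_mem.mp hx
  have h1 : p.fiberMap g (r • x) ∈ Q := by
    rw [← algebraMap_smul p.ResidueField, map_smul, Algebra.smul_def]
    exact Q.mul_mem_left _ hx
  rw [hs, p.fiberMap_one_tmul] at h1
  rw [h s h1, ← algebraMap_smul p.ResidueField] at hs
  exact (p.isUnit_algebraMap_residueField hr).smul_eq_zero.mp hs

theorem exists_comap_eq_of_isMin_comap_preimage [IsDomain B] [IsIntegrallyClosed R]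
    (hg : Function.Injective g) {a : A} (ha : algebraMap A R a ≠ 0)
    (h : ∀ b, ∃ N : ℕ, g.toRingHom.IsIntegralElem (a ^ N • b)) (hp : a ∉ p)
    (P : PrimeSpectrum R) (hP : P.asIdeal.under A = p) (q : PrimeSpectrum B)
    (hq : PrimeSpectrum.comap (algebraMap A B) q = ⟨p, ‹_›⟩)
    (hPq : P ≤ PrimeSpectrum.comap g.toRingHom q)
    (hqm : ∀ q', PrimeSpectrum.comap (algebraMap A B) q' = ⟨p, ‹_›⟩ → q' ≤ q → q' = q) :
    PrimeSpectrum.comap g.toRingHom q = P := by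
  algebraize [g.toRingHom]
  have : IsScalarTower A R B := .of_algebraMap_eq' g.comp_algebraMap.symm
  obtain ⟨q', hq', rfl⟩ := PrimeSpectrum.exists_le_comap_eq_of_forall_isIntegral_pow_smul
    (R := R) (S := B) (r := algebraMap A R a) hg ha
    (fun b ↦ (h b).imp fun N hN ↦ by rwa [← map_pow, algebraMap_smul]) P q hPq (by
      change algebraMap R B (algebraMap A R a) ∉ q.asIdeal
      rw [← IsScalarTower.algebraMap_apply]
      exact fun hb ↦ hp (hq.le hb))
  rw [hqm q' _ hq']
  · rfl
  · ext x
    rw [IsScalarTower.algebraMap_eq A R B, PrimeSpectrum.comap_comp_apply]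
    exact iff_of_eq congr(x ∈ $hP)

theorem Ideal.ringKrullDim_fiber_quotient_eq {a : A} (ha : a ∉ p)
    (h : ∀ b, ∃ N : ℕ, g.toRingHom.IsIntegralElem (a ^ N • b)) (Q : Ideal (p.Fiber B))
    (hQ : ∀ x : R, (1 ⊗ₜ g x : p.Fiber B) ∈ Q → (1 ⊗ₜ x : p.Fiber R) = 0) :
    ringKrullDim (p.Fiber B ⧸ Q) = ringKrullDim (p.Fiber R) := by
  refine RingHom.ringKrullDim_quotient_eq_of_isIntegral (R := p.Fiber R) (S := p.Fiber B)
    (f := (p.fiberMap g).toRingHom)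
    (p.fiberMap_isIntegral g ha h) Q ?_
  exact p.injective_mk_comp_fiberMap g Q hQ

theorem isPureDimOn_comap_preimage [IsDomain B] [IsIntegrallyClosed R]
    (hg : Function.Injective g) {a : A} (ha : algebraMap A R a ≠ 0)
    (h : ∀ b, ∃ N : ℕ, g.toRingHom.IsIntegralElem (a ^ N • b))
    (p : PrimeSpectrum A) [IsDomain (p.asIdeal.Fiber R)] (hp : a ∉ p.asIdeal) :
    IsPureDimOn (PrimeSpectrum.comap (algebraMap A B) ⁻¹' {p})
      (ringKrullDim (p.asIdeal.Fiber R)) := by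
  let e := (PrimeSpectrum.preimageHomeomorphFiber A B p).symm
  have he := IsEmbedding.subtypeVal.comp e.isEmbedding
  convert! isPureDimOn_range_of_forall_irreducibleComponents he
    (d := ringKrullDim (p.asIdeal.Fiber R)) ?_ using 1
  · rw [e.surjective.range_comp, Subtype.range_coe]
  intro C hC
  rw [← PrimeSpectrum.zeroLocus_minimalPrimes] at hC
  obtain ⟨Q, hQ, rfl⟩ := hC
  have hQ' : Q.IsPrime := hQ.1.1
  let q := (PrimeSpectrum.preimageOrderIsoFiber A B p).symm ⟨Q, hQ'⟩
  let P := (PrimeSpectrum.preimageEquivFiber A R p).symm ⟨⊥, Ideal.isPrime_bot⟩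
  have hP (x : R) : x ∈ P.1.asIdeal ↔ (1 ⊗ₜ x : p.asIdeal.Fiber R) = 0 := .rfl
  have hq (x : B) : x ∈ q.1.asIdeal ↔ (1 ⊗ₜ x : p.asIdeal.Fiber B) ∈ Q := .rfl
  have hPq : PrimeSpectrum.comap g.toRingHom q.1 = P.1 := by
    refine exists_comap_eq_of_isMin_comap_preimage g p.asIdeal hg ha h hp P.1
      (congrArg PrimeSpectrum.asIdeal P.2) q.1 q.2 ?_ ?_
    · intro x hx
      refine (hq _).mpr ?_
      change (1 : p.asIdeal.ResidueField) ⊗ₜ[A] g x ∈ Q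
      rw [← p.asIdeal.fiberMap_one_tmul, (hP x).mp hx, map_zero]
      exact zero_mem _
    · intro q' hq' hle
      have hle' : PrimeSpectrum.preimageOrderIsoFiber A B p ⟨q', hq'⟩ ≤ ⟨Q, hQ'⟩ := by
        rw [← OrderIso.le_symm_apply]; exact hle
      have := hQ.2 ⟨(PrimeSpectrum.preimageOrderIsoFiber A B p ⟨q', hq'⟩).2, bot_le⟩ hle'
      have h2 : PrimeSpectrum.preimageOrderIsoFiber A B p ⟨q', hq'⟩ = ⟨Q, hQ'⟩ :=
        le_antisymm hle' this
      exact congrArg Subtype.val ((OrderIso.eq_symm_apply _).mpr h2)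
  change topologicalKrullDim (PrimeSpectrum.zeroLocus (Q : Set (p.asIdeal.Fiber B))) = _
  rw [topologicalKrullDim_zeroLocus]
  refine p.asIdeal.ringKrullDim_fiber_quotient_eq g hp h Q fun x hx ↦ (hP x).mp (hPq.le ?_)
  exact (hq _).mpr hx

end FibrePurity

section MvPolynomial

variable {A : Type*} [CommRing A] (p : Ideal A) [p.IsPrime] (n : ℕ)

instance : IsDomain (p.Fiber (MvPolynomial (Fin n) A)) :=
  (MvPolynomial.algebraTensorAlgEquiv A p.ResidueField).toMulEquiv.isDomain

theorem Ideal.ringKrullDim_fiber_mvPolynomial :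
    ringKrullDim (p.Fiber (MvPolynomial (Fin n) A)) = n := by
  rw [ringKrullDim_eq_of_ringEquiv
    (MvPolynomial.algebraTensorAlgEquiv A p.ResidueField).toRingEquiv]
  simp

end MvPolynomial

section GenericFibre

theorem IsDiscrete.exists_isOpen_isClosed_inter_eq_singleton {X : Type*} [TopologicalSpace X]
    {T : Set X} (hT : IsDiscrete T) {p : X} (hp : p ∈ T) :
    ∃ U Z, IsOpen U ∧ IsClosed Z ∧ T ∩ U = {p} ∧ T ∩ Z = {p} := by
  have h (q) (hq : q ∈ T) : ∃ U, IsOpen U ∧ T ∩ U = {q} := by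
    have := hT.to_subtype
    obtain ⟨U, hU, hq'⟩ := isOpen_induced_iff.mp (isOpen_discrete {(⟨q, hq⟩ : T)})
    refine ⟨U, hU, ?_⟩
    rw [← Subtype.image_preimage_coe, hq', Set.image_singleton]
  obtain ⟨U, hU, hUp⟩ := h p hp
  refine ⟨U, closure {p}, hU, isClosed_closure, hUp, ?_⟩
  refine subset_antisymm (fun q ⟨hq, hqp⟩ ↦ ?_) (by simpa using ⟨hp, subset_closure rfl⟩)
  obtain ⟨V, hV, hVq⟩ := h q hq
  have hqV : q ∈ T ∩ V := hVq ▸ rfl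
  obtain ⟨x, hx, rfl⟩ := mem_closure_iff.mp hqp V hV hqV.2
  have : x ∈ T ∩ V := ⟨hp, hx⟩
  rw [hVq] at this
  exact this.symm

theorem ringKrullDim_eq_of_isAlgebraic (k : Type*) {R B : Type*} [Field k] [CommRing R]
    [CommRing B] [IsDomain B] [Algebra k R] [Algebra k B] [Algebra R B] [IsScalarTower k R B]
    [Algebra.FiniteType k R] [Algebra.FiniteType k B] [Algebra.IsAlgebraic R B]
    (h : Function.Injective (algebraMap R B)) : ringKrullDim B = ringKrullDim R := by
  have : IsDomain R := h.isDomain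
  have : FaithfulSMul R B := (faithfulSMul_iff_algebraMap_injective _ _).mpr h
  obtain ⟨s, h1, h2⟩ := exists_ringKrullDim_eq_trdeg k R
  obtain ⟨t, h3, h4⟩ := exists_ringKrullDim_eq_trdeg k B
  have := lift_trdeg_add_eq k R B
  rw [trdeg_eq_zero (R := R)] at this
  simp only [h2, h4, Cardinal.lift_zero, add_zero, Cardinal.lift_natCast, Nat.cast_inj] at this
  rw [h1, h3, this]

variable {A B : Type*} [CommRing A] [CommRing B]

theorem exists_isPureDimOn_comap_preimage_of_uniqueFactorizationMonoid (k : Type*) [Field k]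
    [Algebra k A] [IsDomain A] [UniqueFactorizationMonoid A] [Algebra.FiniteType k A] [IsDomain B]
    [Algebra A B] [Algebra.FiniteType A B] (hinj : Function.Injective (algebraMap A B)) :
    ∃ a : A, a ≠ 0 ∧ ∃ n : ℕ, ringKrullDim B = n + ringKrullDim A ∧
      ∀ p : PrimeSpectrum A, a ∉ p.asIdeal →
        IsPureDimOn (PrimeSpectrum.comap (algebraMap A B) ⁻¹' {p}) n := by
  obtain ⟨n, g, a, ha, hg, h⟩ :=
    exists_mvPolynomial_algHom_injective_forall_isIntegralElem hinj
  refine ⟨a, ha, n, ?_, fun p hp ↦ ?_⟩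
  · have : IsNoetherianRing A := Algebra.FiniteType.isNoetherianRing k A
    rw [add_comm]
    have e := MvPolynomial.ringKrullDim_of_isNoetherianRing (R := A) (ι := Fin n)
    rw [Nat.card_fin] at e
    rw [← e]
    algebraize [g.toRingHom, (algebraMap A B).comp (algebraMap k A)]
    have : IsScalarTower A (MvPolynomial (Fin n) A) B :=
      .of_algebraMap_eq' g.comp_algebraMap.symm
    have : Algebra.FiniteType k B := .trans ‹_› ‹Algebra.FiniteType A B›
    have : Algebra.FiniteType k (MvPolynomial (Fin n) A) := .trans (S := A) ‹_› inferInstance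
    have : IsScalarTower k (MvPolynomial (Fin n) A) B := .of_algebraMap_eq fun x ↦ by
      rw [IsScalarTower.algebraMap_apply k A (MvPolynomial (Fin n) A),
        ← IsScalarTower.algebraMap_apply A (MvPolynomial (Fin n) A) B]; rfl
    have : Algebra.IsAlgebraic (MvPolynomial (Fin n) A) B := ⟨fun b ↦ by
      obtain ⟨N, hN⟩ := h b
      refine IsAlgebraic.iff_exists_smul_integral.mpr
        ⟨algebraMap A (MvPolynomial (Fin n) A) (a ^ N), by simp [ha], ?_⟩
      rw [algebraMap_smul]
      exact hN⟩
    exact ringKrullDim_eq_of_isAlgebraic k hg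
  · rw [← p.asIdeal.ringKrullDim_fiber_mvPolynomial n]
    exact isPureDimOn_comap_preimage g hg (by simpa using ha) h p hp

theorem exists_forall_exists_comap_eq [IsDomain A] [IsDomain B]
    [Algebra A B] [Algebra.FiniteType A B] (hinj : Function.Injective (algebraMap A B)) :
    ∃ a : A, a ≠ 0 ∧ ∀ p : PrimeSpectrum A, a ∉ p.asIdeal →
        (PrimeSpectrum.comap (algebraMap A B) ⁻¹' {p}).Nonempty := by
  obtain ⟨n, g, a, ha, hg, h⟩ :=
    exists_mvPolynomial_algHom_injective_forall_isIntegralElem hinj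
  refine ⟨a, ha, fun p hp ↦ ?_⟩
  algebraize [g.toRingHom]
  have : IsScalarTower A (MvPolynomial (Fin n) A) B :=
    .of_algebraMap_eq' g.comp_algebraMap.symm
  let P := (PrimeSpectrum.preimageEquivFiber A (MvPolynomial (Fin n) A) p).symm
    ⟨⊥, Ideal.isPrime_bot⟩
  obtain ⟨q, hq⟩ := PrimeSpectrum.exists_comap_eq_of_forall_isIntegral_pow_smul
    (R := MvPolynomial (Fin n) A) (S := B) (r := algebraMap A _ a) hg
    (fun b ↦ (h b).imp fun N hN ↦ by rwa [← map_pow, algebraMap_smul]) P.1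
    fun h' ↦ hp (P.2.le h')
  refine ⟨q, ?_⟩
  rw [Set.mem_preimage, IsScalarTower.algebraMap_eq A (MvPolynomial (Fin n) A) B,
    PrimeSpectrum.comap_comp_apply, hq]
  exact P.2

theorem exists_isPureDimOn_comap_preimage (k : Type*) [Field k] [Algebra k A] [IsDomain A]
    [Algebra.FiniteType k A] [IsDomain B] [Algebra A B] [Algebra.FiniteType A B] :
    ∃ a : A, a ≠ 0 ∧
      ((∀ p : PrimeSpectrum A, a ∉ p.asIdeal →
        PrimeSpectrum.comap (algebraMap A B) ⁻¹' {p} = ∅) ∨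
      ∃ n : ℕ, ringKrullDim B = n + ringKrullDim A ∧ ∀ p : PrimeSpectrum A, a ∉ p.asIdeal →
        (PrimeSpectrum.comap (algebraMap A B) ⁻¹' {p}).Nonempty ∧
        IsPureDimOn (PrimeSpectrum.comap (algebraMap A B) ⁻¹' {p}) n) := by
  by_cases hinj : Function.Injective (algebraMap A B)
  swap
  · rw [injective_iff_map_eq_zero] at hinj
    push Not at hinj
    obtain ⟨a, ha, ha0⟩ := hinj
    refine ⟨a, ha0, .inl fun p hp ↦ Set.eq_empty_of_forall_notMem ?_⟩
    rintro q rfl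
    exact hp (show algebraMap A B a ∈ q.asIdeal by simp [ha])
  obtain ⟨m, ν, hν, hfin⟩ := exists_finite_inj_algHom_of_fg k A
  algebraize [ν.toRingHom, (algebraMap A B).comp ν.toRingHom]
  have : Module.Finite (MvPolynomial (Fin m) k) A := hfin
  have : Algebra.FiniteType (MvPolynomial (Fin m) k) B := .trans (S := A) inferInstance ‹_›
  obtain ⟨a₀, ha₀, n, hdim, h⟩ :=
    exists_isPureDimOn_comap_preimage_of_uniqueFactorizationMonoid (A := MvPolynomial (Fin m) k)
      (B := B) k (hinj.comp hν)
  obtain ⟨a₁, ha₁, h₁⟩ := exists_forall_exists_comap_eq hinj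
  refine ⟨ν a₀ * a₁, mul_ne_zero (by simpa using hν.ne ha₀) ha₁, .inr ⟨n, ?_, fun p hp ↦ ?_⟩⟩
  · rw [hdim, ringKrullDim_eq_of_isIntegral_of_injective (R := MvPolynomial (Fin m) k) (S := A) hν]
  refine ⟨h₁ p fun h' ↦ hp (p.asIdeal.mul_mem_left _ h'), ?_⟩
  let p₀ := PrimeSpectrum.comap (algebraMap (MvPolynomial (Fin m) k) A) p
  obtain ⟨U, Z, hU, hZ, hpU, hpZ⟩ :=
    (Algebra.QuasiFinite.isDiscrete_comap_preimage_singleton (S := A) p₀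
      ).exists_isOpen_isClosed_inter_eq_singleton (p := p) rfl
  have hS : PrimeSpectrum.comap (algebraMap (MvPolynomial (Fin m) k) B) ⁻¹' {p₀} =
      PrimeSpectrum.comap (algebraMap A B) ⁻¹'
        (PrimeSpectrum.comap (algebraMap (MvPolynomial (Fin m) k) A) ⁻¹' {p₀}) := by
    rw [IsScalarTower.algebraMap_eq (MvPolynomial (Fin m) k) A B, PrimeSpectrum.comap_comp]
    rfl
  have h2 := h p₀ fun h' ↦ hp (p.asIdeal.mul_mem_right _ h')
  rw [hS] at h2
  have hc := PrimeSpectrum.continuous_comap (algebraMap A B)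
  have h3 := h2.inter_of_isClosed_of_isOpen (hU.preimage hc) (hZ.preimage hc)
    (by rw [← Set.preimage_inter, ← Set.preimage_inter, hpU, hpZ])
  rwa [← Set.preimage_inter, hpU] at h3

end GenericFibre

open PrimeSpectrum in
theorem PrimeSpectrum.topologicalKrullDim_eq_ringKrullDim_quotient_nilradical (A : Type*)
    [CommRing A] : topologicalKrullDim (PrimeSpectrum A) = ringKrullDim (A ⧸ nilradical A) := by
  rw [← topologicalKrullDim_zeroLocus, zeroLocus_nilradical]
  exact ((Homeomorph.Set.univ _).isHomeomorph.topologicalKrullDim_eq _).symm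

open PrimeSpectrum in
theorem exists_isOpen_isPureDimOn_inter_comap_preimage (k : Type*) {A C : Type*} [Field k]
    [CommRing A] [CommRing C] [Algebra k A] [Algebra k C] [Algebra A C] [IsScalarTower k A C]
    [Algebra.FiniteType k A] [Algebra.FiniteType k C] [IrreducibleSpace (PrimeSpectrum A)]
    {T : Set (PrimeSpectrum C)} (hT : IsClosed T) (hTi : IsIrreducible T) :
    ∃ V : Set (PrimeSpectrum A), IsOpen V ∧ V.Nonempty ∧
      ((∀ p ∈ V, T ∩ comap (algebraMap A C) ⁻¹' {p} = ∅) ∨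
      ∃ n : ℕ, topologicalKrullDim T = n + topologicalKrullDim (PrimeSpectrum A) ∧
        ∀ p ∈ V, (T ∩ comap (algebraMap A C) ⁻¹' {p}).Nonempty ∧
          IsPureDimOn (T ∩ comap (algebraMap A C) ⁻¹' {p}) n) := by
  let N := nilradical A
  have hN : N.IsPrime := irreducibleSpace_iff_isPrime_nilradical.mp ‹_›
  let P := vanishingIdeal T
  have hP : P.IsPrime := isIrreducible_iff_vanishingIdeal_isPrime.mp hTi
  have hTP : zeroLocus (P : Set C) = T := by
    rw [zeroLocus_vanishingIdeal_eq_closure, hT.closure_eq]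
  let φ : A ⧸ N →+* C ⧸ P := Ideal.quotientMap P (algebraMap A C) fun x hx ↦ by
    obtain ⟨m, hm⟩ := hx
    exact Ideal.IsPrime.mem_of_pow_mem hP m (by
      rw [← map_pow, (Ideal.mem_bot.mp hm :), map_zero]
      exact P.zero_mem)
  algebraize [φ]
  have : IsScalarTower k (A ⧸ N) (C ⧸ P) := .of_algebraMap_eq fun x ↦ by
    change Ideal.Quotient.mk P (algebraMap k C x) = Ideal.Quotient.mk P (algebraMap A C (algebraMap k A x))
    rw [← IsScalarTower.algebraMap_apply]
  have : Algebra.FiniteType (A ⧸ N) (C ⧸ P) := .of_restrictScalars_finiteType k _ _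
  obtain ⟨a, ha, h⟩ := exists_isPureDimOn_comap_preimage (A := A ⧸ N) (B := C ⧸ P) k
  obtain ⟨a, rfl⟩ := Ideal.Quotient.mk_surjective a
  have heA := isClosedEmbedding_comap_of_surjective _ (Ideal.Quotient.mk N)
    Ideal.Quotient.mk_surjective
  have heC := isClosedEmbedding_comap_of_surjective _ (Ideal.Quotient.mk P)
    Ideal.Quotient.mk_surjective
  have hrC : Set.range (comap (Ideal.Quotient.mk P)) = T := by
    rw [range_comap_of_surjective _ _ Ideal.Quotient.mk_surjective, Ideal.mk_ker, hTP]
  have hrA : Set.range (comap (Ideal.Quotient.mk N)) = Set.univ := by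
    rw [range_comap_of_surjective _ _ Ideal.Quotient.mk_surjective, Ideal.mk_ker,
      zeroLocus_nilradical]
  have hdA : topologicalKrullDim (PrimeSpectrum A) = ringKrullDim (A ⧸ N) :=
    topologicalKrullDim_eq_ringKrullDim_quotient_nilradical A
  have hdC : topologicalKrullDim T = ringKrullDim (C ⧸ P) := by
    rw [← hTP, topologicalKrullDim_zeroLocus]
  have hf (p : PrimeSpectrum (A ⧸ N)) : T ∩ comap (algebraMap A C) ⁻¹' {comap (Ideal.Quotient.mk N) p} =
      comap (Ideal.Quotient.mk P) '' (comap (algebraMap (A ⧸ N) (C ⧸ P)) ⁻¹' {p}) := by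
    rw [← hrC, Set.inter_comm, ← Set.image_preimage_eq_inter_range]
    congr 1
    ext q
    have : comap (algebraMap A C) (comap (Ideal.Quotient.mk P) q) =
        comap (Ideal.Quotient.mk N) (comap (algebraMap (A ⧸ N) (C ⧸ P)) q) := rfl
    rw [Set.mem_preimage, Set.mem_preimage, this, Set.mem_singleton_iff, heA.injective.eq_iff]
    rfl
  have hV (p : PrimeSpectrum A) (hp : p ∈ basicOpen a) :
      ∃ p', Ideal.Quotient.mk N a ∉ p'.asIdeal ∧ comap (Ideal.Quotient.mk N) p' = p := by
    obtain ⟨p', rfl⟩ := hrA.ge (Set.mem_univ p)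
    exact ⟨p', hp, rfl⟩
  refine ⟨basicOpen a, (basicOpen a).isOpen, ?_, ?_⟩
  · refine ⟨⟨N, hN⟩, fun h' ↦ ha (Ideal.Quotient.eq_zero_iff_mem.mpr h')⟩
  obtain h | ⟨n, hd, h⟩ := h
  · refine .inl fun p hp ↦ ?_
    obtain ⟨p, hp, rfl⟩ := hV p hp
    rw [hf, h p hp, Set.image_empty]
  · refine .inr ⟨n, by rw [hdA, hdC, hd], fun p hp ↦ ?_⟩
    obtain ⟨p, hp, rfl⟩ := hV p hp
    rw [hf]
    exact ⟨(h p hp).1.image _, heC.isEmbedding.isPureDimOn_image (h p hp).2⟩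

section KrullDim

open PrimeSpectrum in
theorem topologicalKrullDim_inter_basicOpen (k : Type*) {R : Type*} [Field k] [CommRing R]
    [Algebra k R] [Algebra.FiniteType k R] {T : Set (PrimeSpectrum R)} (hT : IsClosed T)
    (hTi : IsIrreducible T) (a : R) (ha : (T ∩ basicOpen a).Nonempty) :
    topologicalKrullDim (T ∩ basicOpen a : Set (PrimeSpectrum R)) = topologicalKrullDim T := by
  let P := vanishingIdeal T
  have hP : P.IsPrime := isIrreducible_iff_vanishingIdeal_isPrime.mp hTi
  have hTP : zeroLocus (P : Set R) = T := by
    rw [zeroLocus_vanishingIdeal_eq_closure, hT.closure_eq]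
  have haP : Ideal.Quotient.mk P a ≠ 0 := fun h ↦ by
    obtain ⟨x, hxT, hx⟩ := ha
    rw [← hTP] at hxT
    exact hx (hxT (Ideal.Quotient.eq_zero_iff_mem.mp h))
  let L := Localization.Away (Ideal.Quotient.mk P a)
  have he := isClosedEmbedding_comap_of_surjective _ (Ideal.Quotient.mk P)
    Ideal.Quotient.mk_surjective
  have he' := localization_away_isOpenEmbedding L (Ideal.Quotient.mk P a)
  have hr : Set.range (comap (Ideal.Quotient.mk P) ∘ comap (algebraMap (R ⧸ P) L)) =
      T ∩ basicOpen a := by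
    rw [Set.range_comp, localization_away_comap_range L (Ideal.Quotient.mk P a)]
    have : (basicOpen (Ideal.Quotient.mk P a) : Set (PrimeSpectrum (R ⧸ P))) =
      comap (Ideal.Quotient.mk P) ⁻¹' basicOpen a := rfl
    rw [this, Set.image_preimage_eq_inter_range,
      range_comap_of_surjective _ _ Ideal.Quotient.mk_surjective, Ideal.mk_ker, hTP, Set.inter_comm]
  rw [← hr, (he.isEmbedding.comp he'.isEmbedding).topologicalKrullDim_range,
    topologicalKrullDim_eq_ringKrullDim,
    ringKrullDim_eq_of_isLocalization_away (k := k) _ haP L, ← topologicalKrullDim_zeroLocus, hTP]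

open PrimeSpectrum in
theorem topologicalKrullDim_inter_of_isOpen (k : Type*) {R : Type*} [Field k] [CommRing R]
    [Algebra k R] [Algebra.FiniteType k R] {T U : Set (PrimeSpectrum R)} (hT : IsClosed T)
    (hTi : IsIrreducible T) (hU : IsOpen U) (hTU : (T ∩ U).Nonempty) :
    topologicalKrullDim (T ∩ U : Set (PrimeSpectrum R)) = topologicalKrullDim T := by
  obtain ⟨x, hxT, hxU⟩ := hTU
  obtain ⟨_, ⟨_, ⟨a, rfl⟩, rfl⟩, hxa, ha⟩ := isBasis_basic_opens.exists_subset_of_mem_open hxU hU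
  refine le_antisymm (topologicalKrullDim_mono Set.inter_subset_left) ?_
  rw [← topologicalKrullDim_inter_basicOpen k hT hTi a ⟨x, hxT, hxa⟩]
  exact topologicalKrullDim_mono (by gcongr)

variable {k : Type} [Field k]

namespace AlgebraicGeometry.Scheme

/-- The `k`-algebra structure on sections of a `k`-scheme. -/
noncomputable abbrev algebraΓ {X : Scheme} (sX : X ⟶ Spec (.of k)) (W : X.Opens) :
    Algebra k Γ(X, W) :=
  ((sX.appLE ⊤ W le_top).hom.comp (ΓSpecIso (.of k)).inv.hom).toAlgebra

variable {X Y : Scheme}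

/-- The open embedding of the prime spectrum of the sections over an affine open. -/
noncomputable def _root_.AlgebraicGeometry.IsAffineOpen.ofPrimeSpectrum {W : X.Opens}
    (hW : IsAffineOpen W) : PrimeSpectrum Γ(X, W) → X := hW.fromSpec

theorem _root_.AlgebraicGeometry.IsAffineOpen.isOpenEmbedding_ofPrimeSpectrum {W : X.Opens}
    (hW : IsAffineOpen W) : IsOpenEmbedding hW.ofPrimeSpectrum := hW.fromSpec.isOpenEmbedding

theorem _root_.AlgebraicGeometry.IsAffineOpen.range_ofPrimeSpectrum {W : X.Opens}
    (hW : IsAffineOpen W) : Set.range hW.ofPrimeSpectrum = W := hW.range_fromSpec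

theorem _root_.AlgebraicGeometry.IsAffineOpen.irreducibleSpace_primeSpectrum {W : X.Opens}
    (hW : IsAffineOpen W) (hWi : IsIrreducible (W : Set X)) :
    IrreducibleSpace (PrimeSpectrum Γ(X, W)) := by
  rwa [irreducibleSpace_def, Set.top_eq_univ,
    ← hW.isOpenEmbedding_ofPrimeSpectrum.isInducing.isIrreducible_image_iff, Set.image_univ,
    hW.range_ofPrimeSpectrum]

theorem _root_.AlgebraicGeometry.IsAffineOpen.ofPrimeSpectrum_comap_appLE (f : X ⟶ Y)
    {O : Y.Opens} (hO : IsAffineOpen O) {W : X.Opens} (hW : IsAffineOpen W) (hWO : W ≤ f ⁻¹ᵁ O)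
    (q : PrimeSpectrum Γ(X, W)) :
    hO.ofPrimeSpectrum (PrimeSpectrum.comap (f.appLE O W hWO).hom q) = f (hW.ofPrimeSpectrum q) :=
  congr($(hO.SpecMap_appLE_fromSpec f hW hWO) q)

theorem comp_algebraMapΓ {f : X ⟶ Y} {sX : X ⟶ Spec (.of k)} {sY : Y ⟶ Spec (.of k)}
    (hf : f ≫ sY = sX) {O : Y.Opens} {W : X.Opens} (hWO : W ≤ f ⁻¹ᵁ O) :
    (f.appLE O W hWO).hom.comp (sY.appLE ⊤ O le_top).hom = (sX.appLE ⊤ W le_top).hom := by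
  subst hf
  exact congr(($(Scheme.Hom.appLE_comp_appLE f sY ⊤ O W le_top hWO)).hom)

theorem finiteType_algebraΓ (sX : X ⟶ Spec (.of k)) [LocallyOfFiniteType sX]
    {W : X.Opens} (hW : IsAffineOpen W) :
    letI := algebraΓ sX W
    Algebra.FiniteType k Γ(X, W) := by
  have h1 : (ΓSpecIso (.of k)).inv.hom.FiniteType :=
    .of_surjective _ (ConcreteCategory.bijective_of_isIso (ΓSpecIso (.of k)).inv).2
  exact (sX.finiteType_appLE (isAffineOpen_top _) hW le_top).comp h1

theorem topologicalKrullDim_inter_eq_of_le (sX : X ⟶ Spec (.of k)) [LocallyOfFiniteType sX]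
    {W U : X.Opens} (hW : IsAffineOpen W) (hUW : U ≤ W)
    {Z : Set X} (hZ : IsClosed Z) (hZi : IsIrreducible Z) (hZU : (Z ∩ U).Nonempty) :
    topologicalKrullDim (Z ∩ U : Set X) = topologicalKrullDim (Z ∩ W : Set X) := by
  let e := hW.ofPrimeSpectrum
  have he : IsOpenEmbedding e := hW.isOpenEmbedding_ofPrimeSpectrum
  have hr : Set.range e = W := hW.range_ofPrimeSpectrum
  have h1 : Z ∩ W = e '' (e ⁻¹' Z) := by rw [Set.image_preimage_eq_inter_range, hr]
  have h2 : Z ∩ U = e '' (e ⁻¹' Z ∩ e ⁻¹' U) := by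
    rw [← Set.preimage_inter, Set.image_preimage_eq_inter_range, hr, Set.inter_assoc,
      Set.inter_eq_left.mpr (show (U : Set X) ⊆ W from hUW)]
  let := algebraΓ sX W
  have := finiteType_algebraΓ sX hW
  rw [h1, h2, he.isEmbedding.topologicalKrullDim_image, he.isEmbedding.topologicalKrullDim_image]
  refine topologicalKrullDim_inter_of_isOpen k (hZ.preimage he.continuous) ?_
    (U.isOpen.preimage he.continuous) ?_
  · rw [← he.isInducing.isIrreducible_image_iff, ← h1]
    exact hZi.inter_isOpen W.isOpen (hZU.mono (by gcongr))
  · rw [h2] at hZU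
    exact hZU.of_image

theorem topologicalKrullDim_inter_isAffineOpen (sX : X ⟶ Spec (.of k)) [LocallyOfFiniteType sX]
    {W : X.Opens} (hW : IsAffineOpen W) {Z : Set X} (hZ : IsClosed Z) (hZi : IsIrreducible Z)
    (hZW : (Z ∩ W).Nonempty) :
    topologicalKrullDim (Z ∩ W : Set X) = topologicalKrullDim Z := by
  refine le_antisymm (topologicalKrullDim_mono Set.inter_subset_left) ?_
  refine topologicalKrullDim_coe_le_of_forall_exists_isOpen fun x hx ↦ ?_
  obtain ⟨_, ⟨W', hW', rfl⟩, hxW', -⟩ :=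
    X.isBasis_affineOpens.exists_subset_of_mem_open (Set.mem_univ x) isOpen_univ
  refine ⟨W', W'.isOpen, hxW', ?_⟩
  have hne : (Z ∩ (W' ⊓ W : X.Opens)).Nonempty :=
    hZi.2 _ _ W'.isOpen W.isOpen ⟨x, hx, hxW'⟩ hZW
  rw [← topologicalKrullDim_inter_eq_of_le sX hW' inf_le_left hZ hZi hne,
    topologicalKrullDim_inter_eq_of_le sX hW inf_le_right hZ hZi hne]

theorem exists_isOpen_isPureDimOn_inter_preimage {sX : X ⟶ Spec (.of k)} {sY : Y ⟶ Spec (.of k)}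
    [LocallyOfFiniteType sX] [LocallyOfFiniteType sY] {f : X ⟶ Y} (hf : f ≫ sY = sX) {O : Y.Opens}
    (hO : IsAffineOpen O) (hOi : IsIrreducible (O : Set Y)) {W : X.Opens} (hW : IsAffineOpen W)
    (hWO : W ≤ f ⁻¹ᵁ O) {Z : Set X} (hZ : IsClosed Z) (hZi : IsIrreducible Z)
    (hZW : (Z ∩ W).Nonempty) :
    ∃ V : Set Y, IsOpen V ∧ V.Nonempty ∧ V ⊆ O ∧
      ((∀ y ∈ V, f ⁻¹' {y} ∩ Z ∩ W = ∅) ∨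
      ∃ n : ℕ, topologicalKrullDim Z = n + topologicalKrullDim O ∧
        ∀ y ∈ V, (f ⁻¹' {y} ∩ Z ∩ W).Nonempty ∧ IsPureDimOn (f ⁻¹' {y} ∩ Z ∩ W) n) := by
  have he := hW.isOpenEmbedding_ofPrimeSpectrum
  have hr := hW.range_ofPrimeSpectrum
  have heO := hO.isOpenEmbedding_ofPrimeSpectrum
  have hrO := hO.range_ofPrimeSpectrum
  have h1 : Z ∩ W = hW.ofPrimeSpectrum '' (hW.ofPrimeSpectrum ⁻¹' Z) := by
    rw [Set.image_preimage_eq_inter_range, hr]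
  let := algebraΓ sX W
  have := finiteType_algebraΓ sX hW
  let := algebraΓ sY O
  have := finiteType_algebraΓ sY hO
  let := (f.appLE O W hWO).hom.toAlgebra
  have : IsScalarTower k Γ(Y, O) Γ(X, W) := .of_algebraMap_eq' <| by
    change (sX.appLE ⊤ W le_top).hom.comp _ = (f.appLE O W hWO).hom.comp
      ((sY.appLE ⊤ O le_top).hom.comp _)
    rw [← RingHom.comp_assoc, comp_algebraMapΓ hf]
  have := hO.irreducibleSpace_primeSpectrum hOi
  have hTi : IsIrreducible (hW.ofPrimeSpectrum ⁻¹' Z) := by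
    rw [← he.isInducing.isIrreducible_image_iff, ← h1]
    exact hZi.inter_isOpen W.isOpen hZW
  have hfib (p : PrimeSpectrum Γ(Y, O)) : f ⁻¹' {hO.ofPrimeSpectrum p} ∩ Z ∩ W =
      hW.ofPrimeSpectrum '' (hW.ofPrimeSpectrum ⁻¹' Z ∩
        PrimeSpectrum.comap (algebraMap Γ(Y, O) Γ(X, W)) ⁻¹' {p}) := by
    rw [Set.image_inter he.injective, ← h1, Set.inter_assoc, Set.inter_comm]
    ext x
    refine and_congr_right fun ⟨_, hxW⟩ ↦ ?_
    obtain ⟨q, rfl⟩ := hr.ge hxW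
    rw [he.injective.mem_set_image, Set.mem_preimage, Set.mem_preimage, Set.mem_singleton_iff,
      ← hO.ofPrimeSpectrum_comap_appLE f hW hWO, heO.injective.eq_iff]
    rfl
  obtain ⟨V, hV, hVne, h⟩ := exists_isOpen_isPureDimOn_inter_comap_preimage k
    (A := Γ(Y, O)) (C := Γ(X, W)) (hZ.preimage he.continuous) hTi
  refine ⟨hO.ofPrimeSpectrum '' V, heO.isOpenMap _ hV, hVne.image _,
    (Set.image_subset_range _ _).trans hrO.le, ?_⟩
  obtain h | ⟨n, hd, h⟩ := h
  · left
    rintro _ ⟨p, hp, rfl⟩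
    rw [hfib, h p hp, Set.image_empty]
  · right
    refine ⟨n, ?_, ?_⟩
    · rw [← he.isEmbedding.topologicalKrullDim_image, ← h1,
        topologicalKrullDim_inter_isAffineOpen sX hW hZ hZi hZW] at hd
      rw [hd, ← heO.isEmbedding.topologicalKrullDim_range, hrO]
      rfl
    · rintro _ ⟨p, hp, rfl⟩
      rw [hfib]
      exact ⟨(h p hp).1.image _, he.isEmbedding.isPureDimOn_image (h p hp).2⟩

end AlgebraicGeometry.Scheme

end KrullDim

section KrullDim

theorem IsPureDimOn.topologicalKrullDim_eq {X : Type*} [TopologicalSpace X]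
    [TopologicalSpace.NoetherianSpace X] {S : Set X} {d : WithBot ℕ∞} (hS : IsPureDimOn S d)
    (hne : S.Nonempty) : topologicalKrullDim S = d := by
  have : TopologicalSpace.NoetherianSpace S := IsInducing.subtypeVal.noetherianSpace
  have hfin : Finite (irreducibleComponents S) :=
    TopologicalSpace.NoetherianSpace.finite_irreducibleComponents
  have hcov : (Set.univ : Set S) ⊆ ⋃ C : irreducibleComponents S, (C : Set S) := fun x _ ↦
    Set.mem_iUnion.mpr ⟨⟨irreducibleComponent x, irreducibleComponent_mem_irreducibleComponents x⟩,
      mem_irreducibleComponent⟩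
  have : Nonempty (irreducibleComponents S) :=
    ⟨irreducibleComponent ⟨_, hne.some_mem⟩, irreducibleComponent_mem_irreducibleComponents _⟩
  have h1 : topologicalKrullDim (Set.univ : Set S) = topologicalKrullDim S :=
    (Homeomorph.Set.univ S).isHomeomorph.topologicalKrullDim_eq _
  rw [← h1, topologicalKrullDim_eq_iSup_of_isClosed_cover
    (fun C ↦ isClosed_of_mem_irreducibleComponents _ C.2) hcov]
  have (C : irreducibleComponents S) :
      topologicalKrullDim (Set.univ ∩ (C : Set S) : Set S) = d := by
    rw [Set.univ_inter, ← IsEmbedding.subtypeVal.topologicalKrullDim_image]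
    exact hS _ (mem_irreducibleComponents_coe_iff.mp C.2)
  simp only [this, ciSup_const]

theorem IsIrreducible.nonempty_inter_iInter {ι X : Type*} [Finite ι] [TopologicalSpace X]
    {S : Set X} (hS : IsIrreducible S) {V : ι → Set X} (hV : ∀ i, IsOpen (V i))
    (hne : ∀ i, (S ∩ V i).Nonempty) : (S ∩ ⋂ i, V i).Nonempty := by
  classical
  have := Fintype.ofFinite ι
  have := isIrreducible_iff_sInter.mp hS (Finset.univ.image V) (by simpa using hV)
    (by simpa using hne)
  simpa [Set.sInter_range] using this

theorem WithBot.iSup_add_const {ι : Type*} [Finite ι] [Nonempty ι] (d : ι → WithBot ℕ∞)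
    (e : WithBot ℕ∞) : ⨆ i, (d i + e) = (⨆ i, d i) + e := by
  obtain ⟨i, hi⟩ := exists_eq_ciSup_of_finite (f := d)
  refine le_antisymm (iSup_le fun j ↦ ?_) ?_
  · gcongr
    exact le_iSup d j
  · rw [← hi]
    exact le_iSup (fun i ↦ d i + e) i

theorem PrimeSpectrum.exists_topologicalKrullDim_eq_natCast (k : Type*) {R : Type*} [Field k]
    [CommRing R] [Algebra k R] [Algebra.FiniteType k R] [IrreducibleSpace (PrimeSpectrum R)] :
    ∃ s : ℕ, topologicalKrullDim (PrimeSpectrum R) = s := by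
  have := irreducibleSpace_iff_isPrime_nilradical.mp ‹IrreducibleSpace (PrimeSpectrum R)›
  obtain ⟨s, hs, -⟩ := exists_ringKrullDim_eq_trdeg k (R ⧸ nilradical R)
  exact ⟨s, (topologicalKrullDim_eq_ringKrullDim_quotient_nilradical R).trans hs⟩

namespace AlgebraicGeometry.Scheme

variable {k : Type} [Field k] {X Y : Scheme}

theorem exists_topologicalKrullDim_eq_natCast (sY : Y ⟶ Spec (.of k)) [LocallyOfFiniteType sY]
    {O : Y.Opens} (hO : IsAffineOpen O) (hOi : IsIrreducible (O : Set Y)) :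
    ∃ s : ℕ, topologicalKrullDim (O : Set Y) = s := by
  have heO := hO.isOpenEmbedding_ofPrimeSpectrum
  have hrO := hO.range_ofPrimeSpectrum
  let := algebraΓ sY O
  have := finiteType_algebraΓ sY hO
  have := hO.irreducibleSpace_primeSpectrum hOi
  rw [← hrO, heO.isEmbedding.topologicalKrullDim_range]
  exact PrimeSpectrum.exists_topologicalKrullDim_eq_natCast k

theorem exists_isOpen_isPureDimOn_inter {sX : X ⟶ Spec (.of k)} {sY : Y ⟶ Spec (.of k)}
    [LocallyOfFiniteType sX] [LocallyOfFiniteType sY] [TopologicalSpace.NoetherianSpace X]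
    {f : X ⟶ Y} (hf : f ≫ sY = sX) {O : Y.Opens}
    (hO : IsAffineOpen O) (hOi : IsIrreducible (O : Set Y))
    {Z : Set X} (hZ : IsClosed Z) (hZi : IsIrreducible Z) :
    ∃ (V : Set Y) (d : WithBot ℕ∞), IsOpen V ∧ V.Nonempty ∧ V ⊆ O ∧ ∀ y ∈ V,
      topologicalKrullDim (f ⁻¹' {y} ∩ Z : Set X) = d ∧ IsPureDimOn (f ⁻¹' {y} ∩ Z) d ∧
      ((f ⁻¹' {y} ∩ Z).Nonempty → topologicalKrullDim Z = d + topologicalKrullDim O) := by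
  have hW (x : f ⁻¹ᵁ O) : ∃ W : X.Opens, IsAffineOpen W ∧ (x : X) ∈ W ∧ W ≤ f ⁻¹ᵁ O := by
    obtain ⟨_, ⟨W, hW, rfl⟩, hxW, hle⟩ :=
      X.isBasis_affineOpens.exists_subset_of_mem_open x.2 (f ⁻¹ᵁ O).isOpen
    exact ⟨W, hW, hxW, hle⟩
  choose W hWa hxW hWO using hW
  obtain ⟨t, ht⟩ := (TopologicalSpace.NoetherianSpace.isCompact (f ⁻¹ᵁ O : Set X)).elim_finite_subcover
    (fun x ↦ (W x : Set X)) (fun x ↦ (W x).isOpen)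
    fun x hx ↦ Set.mem_iUnion.mpr ⟨⟨x, hx⟩, hxW ⟨x, hx⟩⟩
  have hV (x : t) : ∃ V : Set Y, IsOpen V ∧ V.Nonempty ∧ V ⊆ O ∧
      ((∀ y ∈ V, f ⁻¹' {y} ∩ Z ∩ W x = ∅) ∨
      ∃ n : ℕ, topologicalKrullDim Z = n + topologicalKrullDim O ∧
        ∀ y ∈ V, (f ⁻¹' {y} ∩ Z ∩ W x).Nonempty ∧ IsPureDimOn (f ⁻¹' {y} ∩ Z ∩ W x) n) := by
    by_cases h : (Z ∩ W x).Nonempty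
    · exact exists_isOpen_isPureDimOn_inter_preimage hf hO hOi (hWa x) (hWO x) hZ hZi h
    · refine ⟨O, O.isOpen, hOi.nonempty, subset_rfl, .inl fun y hy ↦ ?_⟩
      rw [Set.inter_assoc, Set.not_nonempty_iff_eq_empty.mp h, Set.inter_empty]
  choose V hVo hVne hVO hV using hV
  have hcov (y : Y) (hy : y ∈ O) (x : X) (hx : x ∈ f ⁻¹' {y}) : ∃ i : t, x ∈ W i := by
    obtain rfl : f x = y := hx
    simpa using! ht hy
  have hVn : ((O : Set Y) ∩ ⋂ i, V i).Nonempty := hOi.nonempty_inter_iInter hVo fun i ↦ by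
    rw [Set.inter_eq_right.mpr (hVO i)]
    exact hVne i
  have hVopen : IsOpen ((O : Set Y) ∩ ⋂ i, V i) := O.isOpen.inter (isOpen_iInter_of_finite hVo)
  have hmem {y : Y} (hy : y ∈ (O : Set Y) ∩ ⋂ i, V i) (i : t) : y ∈ V i :=
    Set.mem_iInter.mp hy.2 i
  by_cases hemp : ∀ i, ∀ y ∈ V i, f ⁻¹' {y} ∩ Z ∩ W i = ∅
  · refine ⟨_, ⊥, hVopen, hVn, Set.inter_subset_left, fun y hy ↦ ?_⟩
    have : f ⁻¹' {y} ∩ Z = ∅ := by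
      refine Set.eq_empty_of_forall_notMem fun x hx ↦ ?_
      obtain ⟨i, hi⟩ := hcov y hy.1 x hx.1
      exact (hemp i y (hmem hy i)).le ⟨hx, hi⟩
    rw [this]
    refine ⟨?_, fun C hC ↦ ?_, fun h ↦ (Set.not_nonempty_empty h).elim⟩
    · exact Order.krullDim_eq_bot_iff.mpr ⟨fun C ↦ C.isIrreducible.nonempty.some.2⟩
    · exact (hC.1.1.nonempty.mono hC.1.2).ne_empty rfl |>.elim
  · push Not at hemp
    obtain ⟨i, y, hy, hne⟩ := hemp
    obtain ⟨n, hn, hi⟩ := (hV i).resolve_left fun h ↦ hne.ne_empty (h y hy)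
    have hp (y : Y) (hy : y ∈ (O : Set Y) ∩ ⋂ i, V i) : IsPureDimOn (f ⁻¹' {y} ∩ Z) n := by
      refine IsPureDimOn.of_isOpen_cover fun x hx ↦ ?_
      obtain ⟨j, hj⟩ := hcov y hy.1 x hx.1
      refine ⟨W j, (W j).isOpen, hj, ?_⟩
      obtain ⟨m, hm, hj'⟩ := (hV j).resolve_left fun h ↦ (h y (hmem hy j)).le ⟨hx, hj⟩
      obtain ⟨s, hs⟩ := exists_topologicalKrullDim_eq_natCast sY hO hOi
      obtain rfl : n = m := by
        have := hn.symm.trans hm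
        change (n : WithBot ℕ∞) + topologicalKrullDim (O : Set Y) =
          m + topologicalKrullDim (O : Set Y) at this
        rw [hs] at this
        exact Nat.add_right_cancel (m := s) (by exact_mod_cast this)
      exact (hj' y (hmem hy j)).2
    exact ⟨_, n, hVopen, hVn, Set.inter_subset_left, fun y hy ↦
      ⟨(hp y hy).topologicalKrullDim_eq ((hi y (hmem hy i)).1.mono Set.inter_subset_left), hp y hy,
        fun _ ↦ hn⟩⟩

theorem exists_isOpen_forall_irreducibleComponents {sX : X ⟶ Spec (.of k)}
    {sY : Y ⟶ Spec (.of k)} [LocallyOfFiniteType sX] [LocallyOfFiniteType sY]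
    [TopologicalSpace.NoetherianSpace X] [TopologicalSpace.NoetherianSpace Y]
    {f : X ⟶ Y} (hf : f ≫ sY = sX) {C : Set Y} (hC : C ∈ irreducibleComponents Y) :
    ∃ (V : Set Y) (d : irreducibleComponents X → WithBot ℕ∞), IsOpen V ∧ V.Nonempty ∧ V ⊆ C ∧
      ∀ y ∈ V, ∀ Z : irreducibleComponents X,
        topologicalKrullDim (f ⁻¹' {y} ∩ Z : Set X) = d Z ∧ IsPureDimOn (f ⁻¹' {y} ∩ Z) (d Z) ∧
        ((f ⁻¹' {y} ∩ Z).Nonempty → topologicalKrullDim (Z : Set X) = d Z + localDim Y y) := by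
  have hCc := isClosed_of_mem_irreducibleComponents C hC
  obtain ⟨o, ho, ⟨y₀, hy₀⟩, hoC⟩ :=
    TopologicalSpace.NoetherianSpace.exists_isOpen_nonempty_subset_irreducibleComponent C hC
  obtain ⟨_, ⟨O, hO, rfl⟩, hy₀O, hOo⟩ :=
    Y.isBasis_affineOpens.exists_subset_of_mem_open hy₀ ho
  have hOC : (O : Set Y) ⊆ C := hOo.trans hoC
  have hCO : C ∩ O = O := Set.inter_eq_right.mpr hOC
  have hne : (C ∩ O).Nonempty := ⟨y₀, hOC hy₀O, hy₀O⟩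
  have hOi : IsIrreducible (O : Set Y) := hCO ▸ hC.1.inter_isOpen O.isOpen hne
  have hd : topologicalKrullDim (O : Set Y) = topologicalKrullDim C := by
    rw [← topologicalKrullDim_inter_isAffineOpen sY hO hCc hC.1 hne, hCO]
  have hdY (y : Y) (hy : y ∈ O) : localDim Y y = topologicalKrullDim (O : Set Y) := by
    rw [hd]
    refine le_antisymm (iSup₂_le fun D ⟨hD, hyD⟩ ↦ ?_)
      (le_iSup₂_of_le C ⟨hC, hOC hy⟩ le_rfl)
    refine topologicalKrullDim_mono ?_
    exact hD.1.subset_of_inter_subset O.isOpen hCc ⟨y, hyD, hy⟩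
      (Set.inter_subset_right.trans hOC)
  choose V d hV hVne hVO h using fun Z : irreducibleComponents X ↦
    exists_isOpen_isPureDimOn_inter hf hO hOi (isClosed_of_mem_irreducibleComponents _ Z.2) Z.2.1
  have : Finite (irreducibleComponents X) :=
    TopologicalSpace.NoetherianSpace.finite_irreducibleComponents
  refine ⟨O ∩ ⋂ Z, V Z, d, O.isOpen.inter (isOpen_iInter_of_finite hV),
    hOi.nonempty_inter_iInter hV fun Z ↦ ?_, Set.inter_subset_left.trans hOC, fun y hy Z ↦ ?_⟩
  · rw [Set.inter_eq_right.mpr (hVO Z)]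
    exact hVne Z
  · rw [hdY y hy.1]
    exact h Z y (Set.mem_iInter.mp hy.2 Z)

end AlgebraicGeometry.Scheme

end KrullDim

/-- For a morphism `f : X ⟶ Y` of schemes of finite type over an algebraically closed
field, there is an open dense `U ⊆ Y` on which `y ↦ dim f⁻¹(y)` is locally constant
(with `dim ∅ = ⊥`, i.e. `−∞`), and for every `z ∈ f⁻¹(U)`,
`dim_z X − dim_{f z} Y = dim_z f⁻¹(f z)` (written additively). -/
theorem statement2 {k : Type} [Field k] [IsAlgClosed k]
    (X Y : Scheme) (f : X ⟶ Y)
    (sX : X ⟶ Spec (CommRingCat.of k)) (sY : Y ⟶ Spec (CommRingCat.of k))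
    [LocallyOfFiniteType sX] [LocallyOfFiniteType sY]
    [CompactSpace X] [CompactSpace Y]
    (hcomm : f ≫ sY = sX) :
    ∃ U : Set Y, IsOpen U ∧ Dense U ∧
      IsLocallyConstant (fun y : U => topologicalKrullDim (f.base ⁻¹' {(y : Y)} : Set X)) ∧
      ∀ z : X, f.base z ∈ U →
        localDim X z =
          localDim (f.base ⁻¹' {f.base z} : Set X) ⟨z, rfl⟩ + localDim Y (f.base z) := by
  have : IsNoetherian X := { __ := LocallyOfFiniteType.isLocallyNoetherian sX }
  have : IsNoetherian Y := { __ := LocallyOfFiniteType.isLocallyNoetherian sY }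
  choose V d hV hVne hVC h using fun C : irreducibleComponents Y ↦
    Scheme.exists_isOpen_forall_irreducibleComponents hcomm C.2
  have : Finite (irreducibleComponents X) :=
    TopologicalSpace.NoetherianSpace.finite_irreducibleComponents
  have hZ (Z : irreducibleComponents X) : IsClosed (Z : Set X) :=
    isClosed_of_mem_irreducibleComponents _ Z.2
  have hcov (S : Set X) : S ⊆ ⋃ Z : irreducibleComponents X, (Z : Set X) := fun x _ ↦
    Set.mem_iUnion.mpr ⟨⟨irreducibleComponent x, irreducibleComponent_mem_irreducibleComponents x⟩,
      mem_irreducibleComponent⟩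
  refine ⟨⋃ C, V C, isOpen_iUnion hV, ?_, ?_, fun z hz ↦ ?_⟩
  · refine dense_iff_inter_open.mpr fun G hG ⟨y, hy⟩ ↦ ?_
    let C : irreducibleComponents Y :=
      ⟨irreducibleComponent y, irreducibleComponent_mem_irreducibleComponents y⟩
    obtain ⟨v, hv⟩ := hVne C
    obtain ⟨x, -, hxG, hxV⟩ := C.2.1.2 G (V C) hG (hV C) ⟨y, mem_irreducibleComponent, hy⟩
      ⟨v, hVC C hv, hv⟩
    exact ⟨x, hxG, Set.mem_iUnion_of_mem C hxV⟩
  · refine (IsLocallyConstant.iff_exists_open _).mpr fun y ↦ ?_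
    obtain ⟨C, hC⟩ := Set.mem_iUnion.mp y.2
    have key (y : Y) (hy : y ∈ V C) : topologicalKrullDim (f ⁻¹' {y} : Set X) = ⨆ Z, d C Z := by
      rw [topologicalKrullDim_eq_iSup_of_isClosed_cover hZ (hcov _)]
      exact iSup_congr fun Z ↦ (h C y hy Z).1
    exact ⟨Subtype.val ⁻¹' V C, (hV C).preimage continuous_subtype_val, hC, fun y' hy' ↦
      (key y' hy').trans (key y hC).symm⟩
  · obtain ⟨C, hC⟩ := Set.mem_iUnion.mp hz
    have hF : localDim (f ⁻¹' {f z} : Set X) ⟨z, rfl⟩ =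
        ⨆ Z : {Z : irreducibleComponents X // z ∈ (Z : Set X)}, d C Z := by
      rw [localDim_eq_iSup_of_isClosed_cover _ hZ (hcov _) fun Z ↦ (h C _ hC Z).2.1]
      exact iSup_subtype' (p := fun Z : irreducibleComponents X ↦ z ∈ (Z : Set X))
        (f := fun Z _ ↦ d C Z)
    have hX : localDim X z = ⨆ Z : {Z : irreducibleComponents X // z ∈ (Z : Set X)},
        topologicalKrullDim (Z : Set X) := by
      refine le_antisymm (iSup₂_le fun D hD ↦ ?_) (iSup_le fun Z ↦ ?_)
      · exact le_iSup (fun Z : {Z : irreducibleComponents X // z ∈ (Z : Set X)} ↦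
          topologicalKrullDim (Z : Set X)) ⟨⟨D, hD.1⟩, hD.2⟩
      · exact le_iSup₂_of_le (Z : Set X) ⟨Z.1.2, Z.2⟩ le_rfl
    have : Nonempty {Z : irreducibleComponents X // z ∈ (Z : Set X)} :=
      ⟨⟨_, irreducibleComponent_mem_irreducibleComponents z⟩, mem_irreducibleComponent⟩
    change localDim X z = localDim (f ⁻¹' {f z} : Set X) ⟨z, rfl⟩ + localDim Y (f z)
    rw [hF, hX, ← WithBot.iSup_add_const]
    exact iSup_congr fun Z ↦ (h C _ hC Z).2.2 ⟨z, rfl, Z.2⟩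
end
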